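/- (Feynman–Hellmann formula in ξ.) With b, ν_n, H_n as above and b(·, s) twice differentiable in ξ with ∂_ξ b bounded, ν_n(·, k) is differentiable in ξ and ∂_ξ ν_n(ξ, k) = 2 ∫_ℝ (∫₀^x ∂_ξ b(ξ,t)dt)(∫₀^x b(ξ,t)dt - k) |H_n(ξ,k,x)|² dx. -/

import Mathlib

open MeasureTheory Filter

/-- The primitive `∫₀ˣ b` of the magnetic intensity. -/
noncomputable def prim (b : ℝ → ℝ) (x : ℝ) : ℝ := ∫ t in (0:ℝ)..x, b t

/-- The potential `(∫₀ˣ b - k)²` of the fibered operator `O_b(k)`. -/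
noncomputable def pot (b : ℝ → ℝ) (k x : ℝ) : ℝ := (prim b x - k) ^ 2

/-- `H` is an `L²` eigenfunction of `O_b(k) = -d²/dx² + (∫₀ˣ b - k)²` with eigenvalue `μ`. -/
def IsEigenpair (b : ℝ → ℝ) (k μ : ℝ) (H : ℝ → ℝ) : Prop :=
  ContDiff ℝ 1 H ∧ Differentiable ℝ (deriv H) ∧
  Integrable (fun x => (H x) ^ 2) ∧ H ≠ 0 ∧
  ∀ x, -(deriv (deriv H) x) + pot b k x * H x = μ * H x

/-- `ν` enumerates, strictly increasingly, all the eigenvalues of `O_b(k)`. -/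
def IsEigList (b : ℝ → ℝ) (k : ℝ) (ν : ℕ → ℝ) : Prop :=
  StrictMono ν ∧ (∀ n, ∃ H, IsEigenpair b k (ν n) H) ∧
  (∀ μ H, IsEigenpair b k μ H → ∃ n, μ = ν n)

/-- The standing assumptions on the magnetic intensity `b`: measurable, bounded,
`b ≥ m > 0` a.e., and equal to the constants `b₊` (for `s > M`) resp. `b₋` (for `s < -M`). -/
def Bfield (b : ℝ → ℝ) (m bp bm M : ℝ) : Prop :=
  Measurable b ∧ (∃ C, ∀ s, |b s| ≤ C) ∧ 0 < m ∧ (∀ᵐ s : ℝ, m ≤ b s) ∧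
  0 < bp ∧ 0 < bm ∧ 0 < M ∧
  (∀ s, M < s → b s = bp) ∧ (∀ s, s < -M → b s = bm)


namespace FH
open Set Topology
open scoped NNReal

/-- Linear system `u' = w`, `w' = q u`. -/
structure Sol (q u w : ℝ → ℝ) : Prop where
  hu : ∀ x, HasDerivAt u (w x) x
  hw : ∀ x, HasDerivAt w (q x * u x) x

/-- Clamp to `[-P, P]`. -/
noncomputable def clampR (P y : ℝ) : ℝ := max (-P) (min P y)

lemma clampR_abs_le {P : ℝ} (hP : 0 ≤ P) (y : ℝ) : |clampR P y| ≤ P := by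
  unfold clampR; rw [abs_le]; constructor
  · exact le_max_left _ _
  · exact max_le (by linarith) (min_le_left _ _)

lemma clampR_abs_le' {P : ℝ} (hP : 0 ≤ P) (y : ℝ) : |clampR P y| ≤ |y| := by
  unfold clampR
  rcases le_total P y with h | h
  · rw [min_eq_left h, max_eq_right (by linarith), abs_of_nonneg hP, abs_of_nonneg (by linarith)]; exact h
  · rw [min_eq_right h]
    rcases le_total (-P) y with h' | h'
    · rw [max_eq_right h']
    · rw [max_eq_left h', abs_neg, abs_of_nonneg hP, abs_of_nonpos (by linarith)]; linarith

lemma clampR_eq {P y : ℝ} (h : |y| ≤ P) : clampR P y = y := by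
  rw [abs_le] at h
  unfold clampR; rw [min_eq_right h.2, max_eq_right h.1]

lemma clampR_lip (P y z : ℝ) : |clampR P y - clampR P z| ≤ |y - z| := by
  unfold clampR
  refine (abs_max_sub_max_le_max _ _ _ _).trans ?_
  simp only [sub_self, abs_zero]
  refine max_le (abs_nonneg _) ?_
  refine (abs_min_sub_min_le_max _ _ _ _).trans ?_
  simp

lemma exists_local {q : ℝ → ℝ} (hq : Continuous q) (e : ℝ × ℝ) {T : ℝ} (hT : 0 < T) :
    ∃ y : ℝ → ℝ × ℝ, y 0 = e ∧ ∀ x ∈ Ioo (-T) T, HasDerivAt y ((y x).2, q x * (y x).1) x := by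
  obtain ⟨Q, hQ⟩ : ∃ Q, ∀ x ∈ Icc (-T) T, |q x| ≤ Q := by
    obtain ⟨Q, hQ⟩ := (isCompact_Icc (a := -T) (b := T)).exists_bound_of_continuousOn hq.continuousOn
    exact ⟨Q, hQ⟩
  have hQ0 : 0 ≤ Q := (abs_nonneg _).trans (hQ 0 ⟨by linarith, by linarith⟩)
  set K : ℝ := 1 + Q with hK
  have hK0 : 0 ≤ K := by positivity
  set P : ℝ := ‖e‖ * Real.exp (K * T) with hP
  have hP0 : 0 ≤ P := by positivity
  let f : ℝ → ℝ × ℝ → ℝ × ℝ := fun t y => (clampR P y.2, q t * clampR P y.1)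
  have h0 : (0:ℝ) ∈ Icc (-T) T := ⟨by linarith, by linarith⟩
  have hPL : IsPicardLindelof f (⟨0, h0⟩ : Icc (-T) T) e (K * P * T).toNNReal 0
      (K * P).toNNReal K.toNNReal := by
    have c1 := Real.coe_toNNReal (K * P * T) (by positivity)
    have c2 := Real.coe_toNNReal (K * P) (by positivity)
    have c3 := Real.coe_toNNReal K (by positivity)
    constructor
    · intro t ht
      apply LipschitzOnWith.of_dist_le_mul
      intro y _ z _
      simp only [f, c3, dist_eq_norm, Prod.norm_def, Prod.fst_sub, Prod.snd_sub, Real.norm_eq_abs]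
      have h1 := clampR_lip P y.2 z.2
      have h2 := clampR_lip P y.1 z.1
      have m1 := le_max_left |y.1 - z.1| |y.2 - z.2|
      have m2 := le_max_right |y.1 - z.1| |y.2 - z.2|
      have m0 := (abs_nonneg _).trans m1
      refine max_le ?_ ?_
      · nlinarith
      · rw [← mul_sub, abs_mul]
        have := hQ t ht
        calc |q t| * |clampR P y.1 - clampR P z.1| ≤ Q * max |y.1 - z.1| |y.2 - z.2| := by
              gcongr; exact h2.trans m1
          _ ≤ _ := by nlinarith
    · intro x _
      exact (by fun_prop : Continuous fun t => f t x).continuousOn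
    · intro t ht x _
      simp only [f, c2, Prod.norm_def, Real.norm_eq_abs]
      have h1 := clampR_abs_le hP0 x.2
      have h2 := clampR_abs_le hP0 x.1
      refine max_le ?_ ?_
      · nlinarith
      · rw [abs_mul]
        calc |q t| * |clampR P x.1| ≤ Q * P := by gcongr; exact hQ t ht
          _ ≤ _ := by nlinarith
    · rw [c1, c2]; simp
  obtain ⟨y, hy0, hy⟩ := hPL.exists_eq_forall_mem_Icc_hasDerivWithinAt₀
  simp only at hy0
  have hder : ∀ x ∈ Ioo (-T) T, HasDerivAt y (f x (y x)) x := fun x hx =>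
    (hy x (Ioo_subset_Icc_self hx)).hasDerivAt (Icc_mem_nhds hx.1 hx.2)
  have hbd : ∀ x ∈ Icc (-T) T, ‖f x (y x)‖ ≤ K * ‖y x‖ := by
    intro x hx
    simp only [f, Prod.norm_def, Real.norm_eq_abs]
    have h1 := clampR_abs_le' hP0 (y x).2
    have h2 := clampR_abs_le' hP0 (y x).1
    have m1 := le_max_left |(y x).1| |(y x).2|
    have m2 := le_max_right |(y x).1| |(y x).2|
    have m0 := (abs_nonneg _).trans m1
    refine max_le ?_ ?_
    · nlinarith
    · rw [abs_mul]
      have := hQ x hx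
      calc |q x| * |clampR P (y x).1| ≤ Q * max |(y x).1| |(y x).2| := by
              gcongr; exact h2.trans m1
          _ ≤ _ := by nlinarith
  have hcont : ContinuousOn y (Icc (-T) T) := fun x hx => (hy x hx).continuousWithinAt
  have hright : ∀ x ∈ Ico 0 T, ‖y x‖ ≤ P := by
    intro x hx
    have := norm_le_gronwallBound_of_norm_deriv_right_le (f := y) (f' := fun x => f x (y x)) (δ := ‖e‖) (K := K) (ε := 0)
      (a := 0) (b := x) (hcont.mono (Icc_subset_Icc (by linarith) hx.2.le))
      (fun t ht => (hder t ⟨by linarith [ht.1], ht.2.trans hx.2⟩).hasDerivWithinAt) (by rw [hy0])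
      (fun t ht => by rw [add_zero]; exact hbd t ⟨by linarith [ht.1], (ht.2.trans hx.2).le⟩) x ⟨hx.1, le_rfl⟩
    rw [gronwallBound_ε0, sub_zero] at this
    refine this.trans ?_
    rw [hP]; gcongr; exact hx.2.le
  have hleft : ∀ x ∈ Ico 0 T, ‖y (-x)‖ ≤ P := by
    intro x hx
    have := norm_le_gronwallBound_of_norm_deriv_right_le (f := fun t => y (-t)) (f' := fun x => -f (-x) (y (-x))) (δ := ‖e‖) (K := K) (ε := 0)
      (a := 0) (b := x) (hcont.comp continuous_neg.continuousOn (fun t ht => ⟨by linarith [ht.2, hx.2], by linarith [ht.1]⟩))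
      (fun t ht => by
        have h := (hder (-t) ⟨by linarith [ht.2, hx.2], by linarith [ht.1]⟩).scomp t (hasDerivAt_neg t)
        have h' : HasDerivAt (fun t => y (-t)) (-f (-t) (y (-t))) t := by
          convert! h using 1; simp
        exact h'.hasDerivWithinAt) (by simp [hy0])
      (fun t ht => by rw [add_zero, norm_neg]; exact hbd (-t) ⟨by linarith [ht.2, hx.2], by linarith [ht.1]⟩) x ⟨hx.1, le_rfl⟩
    rw [gronwallBound_ε0, sub_zero] at this
    refine this.trans ?_
    rw [hP]; gcongr; exact hx.2.le
  have hall : ∀ x ∈ Ioo (-T) T, ‖y x‖ ≤ P := by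
    intro x hx
    rcases le_total 0 x with h | h
    · exact hright x ⟨h, hx.2⟩
    · have := hleft (-x) ⟨by linarith, by linarith [hx.1]⟩
      rwa [neg_neg] at this
  refine ⟨y, hy0, fun x hx => ?_⟩
  have h1 := hder x hx
  have h2 := hall x hx
  have e1 : clampR P (y x).1 = (y x).1 := clampR_eq ((norm_fst_le (y x)).trans h2)
  have e2 : clampR P (y x).2 = (y x).2 := clampR_eq ((norm_snd_le (y x)).trans h2)
  simpa [f, e1, e2] using h1

lemma field_lip {q : ℝ → ℝ} {Q t : ℝ} (hQ0 : 0 ≤ Q) (hQ : |q t| ≤ Q) :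
    LipschitzWith (1 + Q).toNNReal (fun y : ℝ × ℝ => (y.2, q t * y.1)) := by
  apply LipschitzWith.of_dist_le_mul
  intro y z
  simp only [Real.coe_toNNReal (1 + Q) (by positivity), dist_eq_norm, Prod.norm_def, Prod.fst_sub, Prod.snd_sub, Real.norm_eq_abs]
  have m1 := le_max_left |y.1 - z.1| |y.2 - z.2|
  have m2 := le_max_right |y.1 - z.1| |y.2 - z.2|
  have m0 := (abs_nonneg _).trans m1
  refine max_le ?_ ?_
  · nlinarith
  · rw [← mul_sub, abs_mul]
    calc |q t| * |y.1 - z.1| ≤ Q * max |y.1 - z.1| |y.2 - z.2| := by gcongr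
      _ ≤ _ := by nlinarith

lemma local_unique {q : ℝ → ℝ} (hq : Continuous q) {T t₀ : ℝ} (h0 : t₀ ∈ Ioo (-T) T) {y z : ℝ → ℝ × ℝ}
    (hy : ∀ x ∈ Ioo (-T) T, HasDerivAt y ((y x).2, q x * (y x).1) x)
    (hz : ∀ x ∈ Ioo (-T) T, HasDerivAt z ((z x).2, q x * (z x).1) x) (he : y t₀ = z t₀) :
    EqOn y z (Ioo (-T) T) := by
  obtain ⟨Q, hQ⟩ := (isCompact_Icc (a := -T) (b := T)).exists_bound_of_continuousOn hq.continuousOn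
  have hQ0 : 0 ≤ Q := (norm_nonneg _).trans (hQ t₀ (Ioo_subset_Icc_self h0))
  exact ODE_solution_unique_of_mem_Ioo (v := fun t y => (y.2, q t * y.1)) (s := fun _ => univ)
    (fun t ht => (field_lip hQ0 (hQ t (Ioo_subset_Icc_self ht))).lipschitzOnWith) h0
    (fun t ht => ⟨hy t ht, mem_univ _⟩) (fun t ht => ⟨hz t ht, mem_univ _⟩) he

lemma Sol.pair {q u w : ℝ → ℝ} (h : Sol q u w) (x : ℝ) :
    HasDerivAt (fun x => (u x, w x)) (w x, q x * u x) x := (h.hu x).prodMk (h.hw x)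

lemma Sol.unique {q u w u' w' : ℝ → ℝ} (hq : Continuous q) (h : Sol q u w) (h' : Sol q u' w') {t : ℝ}
    (h1 : u t = u' t) (h2 : w t = w' t) : u = u' ∧ w = w' := by
  have : ∀ x, (u x, w x) = (u' x, w' x) := by
    intro x
    have := local_unique hq (T := |t| + |x| + 1) (t₀ := t)
      (by rw [mem_Ioo, ← abs_lt]; linarith [abs_nonneg x])
      (y := fun x => (u x, w x)) (z := fun x => (u' x, w' x))
      (fun s _ => h.pair s) (fun s _ => h'.pair s) (by simp [h1, h2])
    exact this (by rw [mem_Ioo, ← abs_lt]; linarith [abs_nonneg t])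
  exact ⟨funext fun x => (Prod.ext_iff.1 (this x)).1, funext fun x => (Prod.ext_iff.1 (this x)).2⟩

lemma exists_sol {q : ℝ → ℝ} (hq : Continuous q) (a c : ℝ) :
    ∃ u w, Sol q u w ∧ u 0 = a ∧ w 0 = c := by
  choose y hy0 hy using fun N : ℕ => exists_local hq (a, c) (T := (N:ℝ) + 1) (by positivity)
  have hag : ∀ N N' : ℕ, N ≤ N' → ∀ x, |x| < (N:ℝ) + 1 → y N x = y N' x := by
    intro N N' hN x hx
    have hNN : (N:ℝ) ≤ N' := by exact_mod_cast hN
    have := local_unique hq (T := (N:ℝ) + 1) (t₀ := 0) (by constructor <;> linarith [(Nat.cast_nonneg N : (0:ℝ) ≤ N)])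
      (hy N) (fun s hs => hy N' s ⟨by linarith [hs.1], by linarith [hs.2]⟩) (by rw [hy0, hy0])
    exact this (by rwa [mem_Ioo, ← abs_lt])
  let Y : ℝ → ℝ × ℝ := fun x => y ⌈|x|⌉₊ x
  have hYN : ∀ N : ℕ, ∀ x : ℝ, |x| ≤ N → Y x = y N x := by
    intro N x hx
    exact hag _ _ (Nat.ceil_le.2 hx) x (lt_of_le_of_lt (Nat.le_ceil _) (by linarith))
  have hY : ∀ x, HasDerivAt Y ((Y x).2, q x * (Y x).1) x := by
    intro x
    set N := ⌈|x|⌉₊ + 1 with hN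
    have hx : |x| < N := by
      have := Nat.le_ceil |x|
      rw [hN]; push_cast; linarith
    have hd := hy N x (by rw [mem_Ioo, ← abs_lt]; linarith)
    rw [← hYN N x hx.le] at hd
    refine hd.congr_of_eventuallyEq ?_
    have : ∀ᶠ z : ℝ in 𝓝 x, |z| < (N:ℝ) := continuous_abs.continuousAt.eventually_lt continuousAt_const hx
    filter_upwards [this] with z hz using hYN N z hz.le
  refine ⟨fun x => (Y x).1, fun x => (Y x).2, ⟨fun x => ?_, fun x => ?_⟩, ?_, ?_⟩
  · exact (hasFDerivAt_fst.comp_hasDerivAt x (hY x))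
  · exact (hasFDerivAt_snd.comp_hasDerivAt x (hY x))
  · simp [Y, hy0]
  · simp [Y, hy0]

end FH


namespace FH
open Set Topology
open scoped NNReal

lemma Sol.neg {q u w : ℝ → ℝ} (h : Sol q u w) :
    Sol (fun x => q (-x)) (fun x => u (-x)) (fun x => -w (-x)) := by
  constructor
  · intro x
    have := (h.hu (-x)).scomp x (hasDerivAt_neg x)
    convert! this using 1; simp
  · intro x
    have := ((h.hw (-x)).scomp x (hasDerivAt_neg x)).neg
    convert! this using 1; simp

lemma Sol.comb {q u w u' w' : ℝ → ℝ} (h : Sol q u w) (h' : Sol q u' w') (s t : ℝ) :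
    Sol q (fun x => s * u x + t * u' x) (fun x => s * w x + t * w' x) := by
  constructor
  · intro x
    exact ((h.hu x).const_mul s).add ((h'.hu x).const_mul t)
  · intro x
    have := ((h.hw x).const_mul s).add ((h'.hw x).const_mul t)
    convert! this using 1; ring

lemma Sol.smul {q u w : ℝ → ℝ} (h : Sol q u w) (s : ℝ) :
    Sol q (fun x => s * u x) (fun x => s * w x) := by
  simpa using h.comb h s 0

lemma Sol.contu {q u w : ℝ → ℝ} (h : Sol q u w) : Continuous u :=
  continuous_iff_continuousAt.2 fun x => (h.hu x).continuousAt
lemma Sol.contw {q u w : ℝ → ℝ} (h : Sol q u w) : Continuous w :=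
  continuous_iff_continuousAt.2 fun x => (h.hw x).continuousAt

/-- Locally uniform convergence. -/
def QConv (qs : ℕ → ℝ → ℝ) (q : ℝ → ℝ) : Prop :=
  ∀ T, ∀ η > 0, ∀ᶠ j in atTop, ∀ x, |x| ≤ T → |qs j x - q x| ≤ η

lemma QConv.neg {qs : ℕ → ℝ → ℝ} {q : ℝ → ℝ} (h : QConv qs q) :
    QConv (fun j x => qs j (-x)) (fun x => q (-x)) := by
  intro T η hη
  filter_upwards [h T η hη] with j hj x hx
  exact hj (-x) (by rwa [abs_neg])

lemma QConv.sub {qs : ℕ → ℝ → ℝ} {q : ℝ → ℝ} (h : QConv qs q) {φ : ℕ → ℕ} (hφ : Tendsto φ atTop atTop) :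
    QConv (fun j => qs (φ j)) q := by
  intro T η hη
  exact hφ.eventually (h T η hη)

lemma bound_right {q u w : ℝ → ℝ} (h : Sol q u w) {X Q D : ℝ} (hQ0 : 0 ≤ Q) (_ : 0 ≤ D)
    (hQ : ∀ x ∈ Icc 0 X, |q x| ≤ Q) (h1 : |u 0| ≤ D) (h2 : |w 0| ≤ D) :
    ∀ x ∈ Icc 0 X, |u x| ≤ D * Real.exp ((1 + Q) * x) ∧ |w x| ≤ D * Real.exp ((1 + Q) * x) := by
  intro x hx
  have := norm_le_gronwallBound_of_norm_deriv_right_le (f := fun x => (u x, w x))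
    (f' := fun x => (w x, q x * u x)) (δ := D) (K := 1 + Q) (ε := 0) (a := 0) (b := X)
    (fun t _ => (h.pair t).continuousAt.continuousWithinAt)
    (fun t _ => (h.pair t).hasDerivWithinAt)
    (by simp only [Prod.norm_def, Real.norm_eq_abs]; exact max_le h1 h2)
    (fun t ht => by
      simp only [Prod.norm_def, Real.norm_eq_abs, add_zero]
      have m1 := le_max_left |u t| |w t|
      have m2 := le_max_right |u t| |w t|
      have m0 := (abs_nonneg _).trans m1
      refine max_le (by nlinarith) ?_
      rw [abs_mul]
      calc |q t| * |u t| ≤ Q * max |u t| |w t| := by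
            gcongr; exact hQ t (Ico_subset_Icc_self ht)
        _ ≤ _ := by nlinarith) x hx
  rw [gronwallBound_ε0, sub_zero] at this
  exact ⟨(norm_fst_le _).trans this, (norm_snd_le _).trans this⟩

lemma conv_right {qs : ℕ → ℝ → ℝ} {q : ℝ → ℝ} (hq : Continuous q) (hQc : QConv qs q)
    {us ws : ℕ → ℝ → ℝ} {u w : ℝ → ℝ} (hs : ∀ j, Sol (qs j) (us j) (ws j)) (h : Sol q u w)
    (h1 : Tendsto (fun j => us j 0) atTop (𝓝 (u 0))) (h2 : Tendsto (fun j => ws j 0) atTop (𝓝 (w 0)))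
    {X : ℝ} (hX : 0 ≤ X) :
    Tendsto (fun j => us j X) atTop (𝓝 (u X)) ∧ Tendsto (fun j => ws j X) atTop (𝓝 (w X)) := by
  obtain ⟨Q, hQ⟩ := (isCompact_Icc (a := 0) (b := X)).exists_bound_of_continuousOn hq.continuousOn
  obtain ⟨U, hU⟩ := (isCompact_Icc (a := 0) (b := X)).exists_bound_of_continuousOn h.contu.continuousOn
  have hQ0 : 0 ≤ Q := (norm_nonneg _).trans (hQ 0 ⟨le_rfl, hX⟩)
  have hU0 : 0 ≤ U := (norm_nonneg _).trans (hU 0 ⟨le_rfl, hX⟩)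
  set K := 2 + Q with hK
  have key : ∀ ε > 0, ∀ᶠ j in atTop, |us j X - u X| ≤ ε ∧ |ws j X - w X| ≤ ε := by
    intro ε hε
    set G := Real.exp (K * X) with hG
    have hG0 : 0 < G := Real.exp_pos _
    set η := min 1 (ε / (2 * (U + 1) * G)) with hη
    have hη0 : 0 < η := by positivity
    set δ := ε / (2 * G) with hδ
    have hδ0 : 0 < δ := by positivity
    have e1 := Metric.tendsto_nhds.1 h1 δ hδ0
    have e2 := Metric.tendsto_nhds.1 h2 δ hδ0
    filter_upwards [e1, e2, hQc X η hη0] with j j1 j2 j3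
    rw [Real.dist_eq] at j1 j2
    have := norm_le_gronwallBound_of_norm_deriv_right_le (f := fun x => (us j x - u x, ws j x - w x))
      (f' := fun x => (ws j x - w x, qs j x * us j x - q x * u x)) (δ := δ) (K := K) (ε := η * U) (a := 0) (b := X)
      (fun t _ => ((((hs j).hu t).sub (h.hu t)).prodMk (((hs j).hw t).sub (h.hw t))).continuousAt.continuousWithinAt)
      (fun t _ => ((((hs j).hu t).sub (h.hu t)).prodMk (((hs j).hw t).sub (h.hw t))).hasDerivWithinAt)
      (by simp only [Prod.norm_def, Real.norm_eq_abs]; exact max_le j1.le j2.le)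
      (fun t ht => by
        simp only [Prod.norm_def, Real.norm_eq_abs]
        have ht' := Ico_subset_Icc_self ht
        have m1 := le_max_left |us j t - u t| |ws j t - w t|
        have m2 := le_max_right |us j t - u t| |ws j t - w t|
        have m0 := (abs_nonneg _).trans m1
        have hq1 : |qs j t - q t| ≤ η := j3 t (by rw [abs_of_nonneg ht.1]; exact ht.2.le)
        have hq2 : |q t| ≤ Q := hQ t ht'
        have hu2 : |u t| ≤ U := hU t ht'
        have hη1 : η ≤ 1 := min_le_left _ _
        have hq3 : |qs j t| ≤ 1 + Q := by
          calc |qs j t| = |(qs j t - q t) + q t| := by ring_nf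
            _ ≤ _ := abs_add_le _ _
            _ ≤ _ := by linarith
        have hηU : 0 ≤ η * U := by positivity
        refine max_le (by nlinarith) ?_
        calc |qs j t * us j t - q t * u t| = |qs j t * (us j t - u t) + (qs j t - q t) * u t| := by ring_nf
          _ ≤ |qs j t| * |us j t - u t| + |qs j t - q t| * |u t| := by
              rw [← abs_mul, ← abs_mul]; exact abs_add_le _ _
          _ ≤ (1 + Q) * max |us j t - u t| |ws j t - w t| + η * U := by gcongr
          _ ≤ _ := by nlinarith) X ⟨hX, le_rfl⟩
    have hKpos : 1 ≤ K := by linarith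
    rw [gronwallBound_of_K_ne_0 (by linarith), sub_zero] at this
    have hb : δ * Real.exp (K * X) + η * U / K * (Real.exp (K * X) - 1) ≤ ε := by
      rw [← hG]
      have hG1 : 1 ≤ G := Real.one_le_exp (by positivity)
      have : η * U / K ≤ η * (U + 1) := by
        rw [div_le_iff₀ (by linarith)]
        have : 0 ≤ η * (U + 1) := by positivity
        nlinarith
      have h3 : η * (U + 1) * G ≤ ε / 2 := by
        have : η ≤ ε / (2 * (U + 1) * G) := min_le_right _ _
        rw [le_div_iff₀ (by positivity)] at this
        linarith
      have h4 : δ * G = ε / 2 := by rw [hδ]; field_simp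
      have h5 : η * U / K * (G - 1) ≤ η * (U + 1) * G := by
        apply mul_le_mul this (by linarith) (by linarith) (by positivity)
      linarith
    exact ⟨(norm_fst_le _).trans (this.trans hb), (norm_snd_le _).trans (this.trans hb)⟩
  constructor
  · rw [Metric.tendsto_nhds]
    intro ε hε
    filter_upwards [key (ε / 2) (by positivity)] with j hj
    rw [Real.dist_eq]; linarith [hj.1]
  · rw [Metric.tendsto_nhds]
    intro ε hε
    filter_upwards [key (ε / 2) (by positivity)] with j hj
    rw [Real.dist_eq]; linarith [hj.2]

lemma conv_all {qs : ℕ → ℝ → ℝ} {q : ℝ → ℝ} (hq : Continuous q) (hQc : QConv qs q)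
    {us ws : ℕ → ℝ → ℝ} {u w : ℝ → ℝ} (hs : ∀ j, Sol (qs j) (us j) (ws j)) (h : Sol q u w)
    (h1 : Tendsto (fun j => us j 0) atTop (𝓝 (u 0))) (h2 : Tendsto (fun j => ws j 0) atTop (𝓝 (w 0)))
    (X : ℝ) :
    Tendsto (fun j => us j X) atTop (𝓝 (u X)) ∧ Tendsto (fun j => ws j X) atTop (𝓝 (w X)) := by
  rcases le_total 0 X with hX | hX
  · exact conv_right hq hQc hs h h1 h2 hX
  · have := conv_right (q := fun x => q (-x)) (by fun_prop) hQc.neg (fun j => (hs j).neg) h.neg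
      (by simpa using h1) (by simpa using h2.neg) (X := -X) (by linarith)
    simp only [neg_neg] at this
    exact ⟨this.1, by simpa using this.2.neg⟩

lemma mono_of_deriv {f f' : ℝ → ℝ} {R : ℝ} (h : ∀ x, HasDerivAt f (f' x) x) (hn : ∀ x, R ≤ x → 0 ≤ f' x) :
    MonotoneOn f (Ici R) := by
  apply monotoneOn_of_deriv_nonneg (convex_Ici R)
  · exact fun x _ => (h x).continuousAt.continuousWithinAt
  · exact fun x _ => (h x).differentiableAt.differentiableWithinAt
  · intro x hx
    rw [interior_Ici] at hx
    rw [(h x).deriv]; exact hn x (le_of_lt hx)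

/-- Decaying to the right, in the form of a closed condition. -/
def Tame (R : ℝ) (u w : ℝ → ℝ) : Prop := ∀ x, R ≤ x → u x * w x ≤ 0

section right
variable {q u w : ℝ → ℝ} {R : ℝ}

lemma Sol.duw (h : Sol q u w) (x : ℝ) : HasDerivAt (fun x => u x * w x) (w x ^ 2 + q x * u x ^ 2) x := by
  convert! (h.hu x).mul (h.hw x) using 1; ring

lemma Sol.duu (h : Sol q u w) (x : ℝ) : HasDerivAt (fun x => u x ^ 2) (2 * (u x * w x)) x := by
  convert! (h.hu x).pow 2 using 1; push_cast; ring

lemma Sol.dww (h : Sol q u w) (x : ℝ) : HasDerivAt (fun x => w x ^ 2) (2 * q x * (u x * w x)) x := by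
  convert! (h.hw x).pow 2 using 1; push_cast; ring

lemma mono_uw (h : Sol q u w) (hq : ∀ x, R ≤ x → 1 ≤ q x) : MonotoneOn (fun x => u x * w x) (Ici R) :=
  mono_of_deriv h.duw fun x hx => by have := hq x hx; positivity

lemma growth (h : Sol q u w) (hq : ∀ x, R ≤ x → 1 ≤ q x) (hnt : ¬ Tame R u w) :
    ∃ x1, ∃ c > 0, ∀ x, x1 ≤ x → c * (x - x1) ≤ u x ^ 2 := by
  unfold Tame at hnt
  push Not at hnt
  obtain ⟨x1, hx1, hc⟩ := hnt
  refine ⟨x1, 2 * (u x1 * w x1), by positivity, fun x hx => ?_⟩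
  have hm : MonotoneOn (fun x => u x ^ 2 - 2 * (u x1 * w x1) * x) (Ici x1) := by
    apply mono_of_deriv (f' := fun x => 2 * (u x * w x) - 2 * (u x1 * w x1))
    · intro y
      simpa using! (h.duu y).sub ((hasDerivAt_id y).const_mul (2 * (u x1 * w x1)))
    · intro y hy
      have := mono_uw h hq (mem_Ici.2 hx1) (mem_Ici.2 (hx1.trans hy)) hy
      simp only at this
      linarith
  have := hm (mem_Ici.2 le_rfl) (mem_Ici.2 hx) hx
  simp only at this
  nlinarith [sq_nonneg (u x1)]

lemma tame_of_bdd (h : Sol q u w) (hq : ∀ x, R ≤ x → 1 ≤ q x) {C : ℝ} (hC : ∀ x, R ≤ x → u x ^ 2 ≤ C) :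
    Tame R u w := by
  by_contra hnt
  obtain ⟨x1, c, hc, hx⟩ := growth h hq hnt
  have hC0 : 0 ≤ C := (sq_nonneg _).trans (hC R le_rfl)
  have h1 := hx (max x1 R + (C + 1) / c) (by have := le_max_left x1 R; have : 0 ≤ (C+1)/c := by positivity
                                             linarith)
  have h2 := hC (max x1 R + (C + 1) / c) (by have := le_max_right x1 R; have : 0 ≤ (C+1)/c := by positivity
                                             linarith)
  have h3 : c * ((C + 1) / c) = C + 1 := by field_simp
  have h4 := le_max_left x1 R
  nlinarith

lemma tame_of_int (h : Sol q u w) (hq : ∀ x, R ≤ x → 1 ≤ q x) (hi : Integrable (fun x => u x ^ 2)) :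
    Tame R u w := by
  by_contra hnt
  obtain ⟨x1, c, hc, hx⟩ := growth h hq hnt
  have hi2 : IntegrableOn (fun x : ℝ => (c : ℝ)) (Ioi (x1 + 1)) := by
    refine Integrable.mono' (hi.integrableOn (s := Ioi (x1 + 1))) (by fun_prop) ?_
    refine (ae_restrict_iff' measurableSet_Ioi).2 (Eventually.of_forall fun x hx' => ?_)
    have := hx x (by linarith [mem_Ioi.1 hx'])
    rw [Real.norm_eq_abs, abs_of_pos hc]
    nlinarith [mem_Ioi.1 hx']
  rw [integrableOn_const_iff] at hi2
  simp [hc.ne'] at hi2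

lemma tame_decay (h : Sol q u w) (hq : ∀ x, R ≤ x → 1 ≤ q x) (ht : Tame R u w) {x : ℝ} (hx : R ≤ x) :
    u x ^ 2 ≤ -(u R * w R) * Real.exp (-(2 * (x - R))) := by
  have ha : MonotoneOn (fun x => Real.exp (2 * x) * (u x * w x)) (Ici R) := by
    apply mono_of_deriv (f' := fun x => Real.exp (2 * x) * (w x ^ 2 + q x * u x ^ 2 + 2 * (u x * w x)))
    · intro y
      have h1 : HasDerivAt (fun x : ℝ => Real.exp (2 * x)) (Real.exp (2 * y) * 2) y := by
        simpa using ((hasDerivAt_id y).const_mul 2).exp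
      convert! h1.mul (h.duw y) using 1; ring
    · intro y hy
      have := hq y hy
      have : 0 ≤ w y ^ 2 + q y * u y ^ 2 + 2 * (u y * w y) := by
        nlinarith [sq_nonneg (u y + w y), sq_nonneg (u y)]
      positivity
  have h1 : -(u x * w x) ≤ -(u R * w R) * Real.exp (-(2 * (x - R))) := by
    have := ha (mem_Ici.2 le_rfl) (mem_Ici.2 hx) hx
    simp only at this
    have e : Real.exp (-(2 * (x - R))) = Real.exp (2 * R) / Real.exp (2 * x) := by
      rw [← Real.exp_sub]; ring_nf
    rw [e, ← mul_div_assoc, le_div_iff₀ (Real.exp_pos _)]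
    linarith
  refine le_trans ?_ h1
  have hb : MonotoneOn (fun x => u x ^ 2 + u x * w x) (Ici R) := by
    apply mono_of_deriv (fun y => (h.duu y).add (h.duw y))
    intro y hy
    have := hq y hy
    nlinarith [sq_nonneg (u y + w y), sq_nonneg (u y)]
  by_contra hcon
  push Not at hcon
  set c := u x ^ 2 + u x * w x with hc
  have hc0 : 0 < c := by linarith
  have hm : MonotoneOn (fun y => u y * w y - c * y) (Ici x) := by
    apply mono_of_deriv (f' := fun y => (w y ^ 2 + q y * u y ^ 2) - c)
    · intro y
      simpa using! (h.duw y).sub ((hasDerivAt_id y).const_mul c)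
    · intro y hy
      have h2 := hb (mem_Ici.2 hx) (mem_Ici.2 (hx.trans hy)) hy
      simp only at h2
      have h3 := ht y (hx.trans hy)
      have := hq y (hx.trans hy)
      nlinarith [sq_nonneg (w y), sq_nonneg (u y)]
  have hd : 0 ≤ (-(u x * w x) + 1) / c := by
    have := ht x hx
    apply div_nonneg <;> linarith
  have h2 := hm (mem_Ici.2 le_rfl) (mem_Ici.2 (by linarith : x ≤ x + (-(u x * w x) + 1) / c)) (by linarith)
  simp only at h2
  have h3 := ht (x + (-(u x * w x) + 1) / c) (by linarith)
  have h4 : c * ((-(u x * w x) + 1) / c) = -(u x * w x) + 1 := by field_simp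
  nlinarith

lemma tame_w (h : Sol q u w) (hq : ∀ x, R ≤ x → 1 ≤ q x) (ht : Tame R u w) {x : ℝ} (hx : R ≤ x) :
    w x ^ 2 ≤ w R ^ 2 := by
  have hm : MonotoneOn (fun y => -(w y ^ 2)) (Ici R) := by
    apply mono_of_deriv (fun y => (h.dww y).neg)
    intro y hy
    have h1 := ht y hy
    have h2 := hq y hy
    nlinarith
  have := hm (mem_Ici.2 le_rfl) (mem_Ici.2 hx) hx
  simp only at this
  linarith

lemma tame_zero (hqc : Continuous q) (h : Sol q u w) (hq : ∀ x, R ≤ x → 1 ≤ q x) (ht : Tame R u w)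
    (h0 : u R * w R = 0) : u = 0 ∧ w = 0 := by
  have hz : ∀ x, R ≤ x → u x = 0 := by
    intro x hx
    have := tame_decay h hq ht hx
    rw [h0] at this
    simp only [neg_zero, zero_mul] at this
    exact pow_eq_zero_iff (two_ne_zero) |>.1 (le_antisymm this (sq_nonneg _))
  have hw0 : w (R + 1) = 0 := by
    have h1 : HasDerivAt u 0 (R + 1) := by
      refine (hasDerivAt_const (R + 1) (0:ℝ)).congr_of_eventuallyEq ?_
      filter_upwards [Ioi_mem_nhds (show R < R + 1 by linarith)] with y hy
      exact hz y (le_of_lt hy)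
    exact (h.hu (R + 1)).unique h1
  have hzero : Sol q (0 : ℝ → ℝ) 0 := ⟨fun x => by simp, fun x => by simp⟩
  exact h.unique hqc hzero (t := R + 1) (by simp [hz (R + 1) (by linarith)]) (by simp [hw0])

lemma tame_bound (h : Sol q u w) (hR : 0 ≤ R) (hq : ∀ x, R ≤ x → 1 ≤ q x) (ht : Tame R u w) {Q : ℝ} (hQ0 : 0 ≤ Q)
    (hQ : ∀ x ∈ Icc 0 R, |q x| ≤ Q) (hD : u 0 ^ 2 + w 0 ^ 2 = 1) {x : ℝ} (hx : 0 ≤ x) :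
    |u x| ≤ Real.exp ((2 + Q) * R) * Real.exp (-x) ∧ |w x| ≤ Real.exp ((2 + Q) * R) := by
  have hb := bound_right h hQ0 zero_le_one hQ (by rw [← sq_le_one_iff_abs_le_one]; nlinarith [sq_nonneg (w 0)])
    (by rw [← sq_le_one_iff_abs_le_one]; nlinarith [sq_nonneg (u 0)])
  simp only [one_mul] at hb
  have e1 : Real.exp ((2 + Q) * R) = Real.exp ((1 + Q) * R) * Real.exp R := by
    rw [← Real.exp_add]; ring_nf
  rcases le_total x R with hxR | hxR
  · obtain ⟨b1, b2⟩ := hb x ⟨hx, hxR⟩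
    have e2 : Real.exp ((1 + Q) * x) ≤ Real.exp ((1 + Q) * R) := by gcongr
    constructor
    · rw [e1, mul_assoc, ← Real.exp_add]
      have : 1 ≤ Real.exp (R + -x) := Real.one_le_exp (by linarith)
      nlinarith [Real.exp_pos ((1 + Q) * R)]
    · rw [e1]
      have : 1 ≤ Real.exp R := Real.one_le_exp (by linarith)
      nlinarith [Real.exp_pos ((1 + Q) * R)]
  · obtain ⟨b1, b2⟩ := hb R ⟨hR, le_rfl⟩
    constructor
    · have h1 := tame_decay h hq ht hxR
      have h2 : -(u R * w R) ≤ Real.exp ((1 + Q) * R) * Real.exp ((1 + Q) * R) := by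
        calc _ ≤ |u R * w R| := neg_le_abs _
          _ = |u R| * |w R| := abs_mul _ _
          _ ≤ _ := by gcongr
      apply abs_le_of_sq_le_sq _ (by positivity)
      refine h1.trans ?_
      calc _ ≤ Real.exp ((1 + Q) * R) * Real.exp ((1 + Q) * R) * Real.exp (-(2 * (x - R))) := by gcongr
        _ = _ := by rw [e1]; simp only [pow_two, ← Real.exp_add]; ring_nf
    · have h1 := tame_w h hq ht hxR
      have h2 : |w x| ≤ |w R| := sq_le_sq.1 h1
      rw [e1]
      have : 1 ≤ Real.exp R := Real.one_le_exp (by linarith)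
      nlinarith [Real.exp_pos ((1 + Q) * R)]

end right
end FH


namespace FH
open Set Topology

/-- Normalized right-decaying solution. -/
structure RT (R : ℝ) (q u w : ℝ → ℝ) : Prop where
  sol : Sol q u w
  unit : u 0 ^ 2 + w 0 ^ 2 = 1
  pos : 0 < u R
  tame : Tame R u w

section
variable {q u w u' w' : ℝ → ℝ} {R : ℝ}

lemma tame_bdd (h : Sol q u w) (hq : ∀ x, R ≤ x → 1 ≤ q x) (ht : Tame R u w) :
    ∀ x, R ≤ x → u x ^ 2 ≤ -(u R * w R) := by
  intro x hx
  refine (tame_decay h hq ht hx).trans ?_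
  have h1 := ht R le_rfl
  have h2 : Real.exp (-(2 * (x - R))) ≤ 1 := Real.exp_le_one_iff.2 (by linarith)
  nlinarith

lemma tame_comb (h : Sol q u w) (h' : Sol q u' w') (hq : ∀ x, R ≤ x → 1 ≤ q x) (ht : Tame R u w)
    (ht' : Tame R u' w') (s t : ℝ) :
    Tame R (fun x => s * u x + t * u' x) (fun x => s * w x + t * w' x) := by
  refine tame_of_bdd (h.comb h' s t) hq (C := 2 * s ^ 2 * (-(u R * w R)) + 2 * t ^ 2 * (-(u' R * w' R))) ?_
  intro x hx
  have h1 := tame_bdd h hq ht x hx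
  have h2 := tame_bdd h' hq ht' x hx
  calc (s * u x + t * u' x) ^ 2 ≤ 2 * s ^ 2 * u x ^ 2 + 2 * t ^ 2 * u' x ^ 2 := by
        nlinarith [sq_nonneg (s * u x - t * u' x)]
    _ ≤ _ := by gcongr

lemma RT.unique (hqc : Continuous q) (hq : ∀ x, R ≤ x → 1 ≤ q x) (h : RT R q u w) (h' : RT R q u' w') :
    u = u' ∧ w = w' := by
  have hz := tame_zero hqc (h.sol.comb h'.sol (u' R) (-u R)) hq
    (tame_comb h.sol h'.sol hq h.tame h'.tame (u' R) (-u R)) (by ring)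
  have h1 := congrFun hz.1 0
  have h2 := congrFun hz.2 0
  simp only [Pi.zero_apply] at h1 h2
  have p := h.pos
  have p' := h'.pos
  have e : u' R = u R := by
    have : u' R ^ 2 = u R ^ 2 := by
      have a1 : (u' R * u 0) ^ 2 = (u R * u' 0) ^ 2 := by congr 1; linarith
      have a2 : (u' R * w 0) ^ 2 = (u R * w' 0) ^ 2 := by congr 1; linarith
      have := h.unit
      have := h'.unit
      calc u' R ^ 2 = u' R ^ 2 * (u 0 ^ 2 + w 0 ^ 2) := by rw [h.unit, mul_one]
        _ = u R ^ 2 * (u' 0 ^ 2 + w' 0 ^ 2) := by linarith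
        _ = _ := by rw [h'.unit, mul_one]
    nlinarith
  rw [e] at h1 h2
  refine h.sol.unique hqc h'.sol (t := 0) ?_ ?_
  · exact mul_left_cancel₀ p.ne' (by linarith)
  · exact mul_left_cancel₀ p.ne' (by linarith)

lemma unit_subseq {f g : ℕ → ℝ} (h : ∀ j, f j ^ 2 + g j ^ 2 = 1) :
    ∃ a c : ℝ, ∃ φ : ℕ → ℕ, StrictMono φ ∧ Tendsto (fun j => f (φ j)) atTop (𝓝 a) ∧
      Tendsto (fun j => g (φ j)) atTop (𝓝 c) ∧ a ^ 2 + c ^ 2 = 1 := by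
  have hb : ∀ j, (f j, g j) ∈ Metric.closedBall (0 : ℝ × ℝ) 1 := by
    intro j
    rw [mem_closedBall_zero_iff, Prod.norm_def]
    refine max_le ?_ ?_
    · rw [Real.norm_eq_abs, ← sq_le_one_iff_abs_le_one]; nlinarith [h j, sq_nonneg (g j)]
    · rw [Real.norm_eq_abs, ← sq_le_one_iff_abs_le_one]; nlinarith [h j, sq_nonneg (f j)]
  obtain ⟨e, _, φ, hφ, ht⟩ := tendsto_subseq_of_bounded Metric.isBounded_closedBall hb
  have t1 : Tendsto (fun j => f (φ j)) atTop (𝓝 e.1) := (continuous_fst.tendsto e).comp ht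
  have t2 : Tendsto (fun j => g (φ j)) atTop (𝓝 e.2) := (continuous_snd.tendsto e).comp ht
  refine ⟨e.1, e.2, φ, hφ, t1, t2, ?_⟩
  refine tendsto_nhds_unique ((t1.pow 2).add (t2.pow 2)) ?_
  simp only [h]; exact tendsto_const_nhds

lemma exists_vanish (hqc : Continuous q) (X : ℝ) :
    ∃ u w, Sol q u w ∧ u 0 ^ 2 + w 0 ^ 2 = 1 ∧ u X = 0 := by
  obtain ⟨A, A', hA, hA0, hA1⟩ := exists_sol hqc 1 0
  obtain ⟨B, B', hB, hB0, hB1⟩ := exists_sol hqc 0 1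
  by_cases hz : A X = 0
  · exact ⟨A, A', hA, by simp [hA0, hA1], hz⟩
  · set n := Real.sqrt (A X ^ 2 + B X ^ 2) with hn
    have hp : 0 < A X ^ 2 + B X ^ 2 := by positivity
    have hn2 : n ^ 2 = A X ^ 2 + B X ^ 2 := Real.sq_sqrt hp.le
    have hn0 : 0 < n := Real.sqrt_pos.2 hp
    refine ⟨_, _, hA.comb hB (B X / n) (-A X / n), ?_, ?_⟩
    · simp only [hA0, hA1, hB0, hB1]
      field_simp
      rw [hn2]; ring
    · ring

lemma QConv.const (q : ℝ → ℝ) : QConv (fun _ => q) q := by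
  intro T η hη
  filter_upwards with j x _
  simpa using hη.le

lemma exists_tame (hqc : Continuous q) (hq : ∀ x, R ≤ x → 1 ≤ q x) :
    ∃ u w, Sol q u w ∧ u 0 ^ 2 + w 0 ^ 2 = 1 ∧ Tame R u w := by
  choose us ws hs hun hv using fun N : ℕ => exists_vanish hqc (N : ℝ)
  obtain ⟨a, c, φ, hφ, ta, tc, hac⟩ := unit_subseq hun
  obtain ⟨u, w, h, h0, h1⟩ := exists_sol hqc a c
  subst h0 h1
  refine ⟨u, w, h, hac, fun x hx => ?_⟩
  obtain ⟨t1, t2⟩ := conv_all hqc (QConv.const q) (fun j => hs (φ j)) h ta tc x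
  refine le_of_tendsto (t1.mul t2) ?_
  have : Tendsto (fun j => ((φ j : ℕ) : ℝ)) atTop atTop := tendsto_natCast_atTop_atTop.comp hφ.tendsto_atTop
  filter_upwards [this.eventually_ge_atTop x] with j hj
  have := mono_uw (hs (φ j)) hq (mem_Ici.2 hx) (mem_Ici.2 (hx.trans hj)) hj
  simpa [hv] using this

lemma RT.of_unit_tame (hqc : Continuous q) (hq : ∀ x, R ≤ x → 1 ≤ q x) (h : Sol q u w)
    (hu : u 0 ^ 2 + w 0 ^ 2 = 1) (ht : Tame R u w) (hp : 0 ≤ u R) : RT R q u w := by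
  refine ⟨h, hu, lt_of_le_of_ne hp fun h0 => ?_, ht⟩
  have := tame_zero hqc h hq ht (by rw [← h0]; ring)
  simp [this.1, this.2] at hu

lemma sign_RT (hqc : Continuous q) (hq : ∀ x, R ≤ x → 1 ≤ q x) (h : Sol q u w)
    (hu : u 0 ^ 2 + w 0 ^ 2 = 1) (ht : Tame R u w) :
    ∃ τ : ℝ, (τ = 1 ∨ τ = -1) ∧ RT R q (fun x => τ * u x) (fun x => τ * w x) := by
  rcases le_total 0 (u R) with hp | hp
  · refine ⟨1, Or.inl rfl, ?_⟩
    simpa using RT.of_unit_tame hqc hq h hu ht hp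
  · refine ⟨-1, Or.inr rfl, RT.of_unit_tame hqc hq (h.smul (-1)) (by simpa using hu) ?_ (by simpa using hp)⟩
    intro x hx
    have := ht x hx
    linarith

lemma exists_RT (hqc : Continuous q) (hq : ∀ x, R ≤ x → 1 ≤ q x) : ∃ u w, RT R q u w := by
  obtain ⟨u, w, h, hu, ht⟩ := exists_tame hqc hq
  obtain ⟨τ, _, h⟩ := sign_RT hqc hq h hu ht
  exact ⟨_, _, h⟩

lemma RT.conv0 {qs : ℕ → ℝ → ℝ} {us ws : ℕ → ℝ → ℝ} (hqc : Continuous q) (hq : ∀ x, R ≤ x → 1 ≤ q x)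
    (hQc : QConv qs q) (hs : ∀ j, RT R (qs j) (us j) (ws j)) (h : RT R q u w) :
    Tendsto (fun j => us j 0) atTop (𝓝 (u 0)) ∧ Tendsto (fun j => ws j 0) atTop (𝓝 (w 0)) := by
  have : Tendsto (fun j => (us j 0, ws j 0)) atTop (𝓝 (u 0, w 0)) := by
    apply tendsto_of_subseq_tendsto
    intro ns hns
    obtain ⟨a, c, φ, hφ, ta, tc, hac⟩ := unit_subseq (fun j => (hs (ns j)).unit)
    obtain ⟨v, z, hv, h0, h1⟩ := exists_sol hqc a c
    subst h0 h1
    have hcv := conv_all hqc (hQc.sub (hns.comp hφ.tendsto_atTop)) (fun j => (hs (ns (φ j))).sol) hv ta tc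
    have hRT : RT R q v z := by
      refine RT.of_unit_tame hqc hq hv hac (fun x hx => ?_) ?_
      · exact le_of_tendsto' ((hcv x).1.mul (hcv x).2) fun j => (hs (ns (φ j))).tame x hx
      · exact ge_of_tendsto' (hcv R).1 fun j => (hs (ns (φ j))).pos.le
    obtain ⟨rfl, rfl⟩ := RT.unique hqc hq hRT h
    exact ⟨φ, ta.prodMk_nhds tc⟩
  exact ⟨(continuous_fst.tendsto _).comp this, (continuous_snd.tendsto _).comp this⟩

lemma RT.conv {qs : ℕ → ℝ → ℝ} {us ws : ℕ → ℝ → ℝ} (hqc : Continuous q) (hq : ∀ x, R ≤ x → 1 ≤ q x)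
    (hQc : QConv qs q) (hs : ∀ j, RT R (qs j) (us j) (ws j)) (h : RT R q u w) (x : ℝ) :
    Tendsto (fun j => us j x) atTop (𝓝 (u x)) ∧ Tendsto (fun j => ws j x) atTop (𝓝 (w x)) :=
  conv_all hqc hQc (fun j => (hs j).sol) h.sol (RT.conv0 hqc hq hQc hs h).1 (RT.conv0 hqc hq hQc hs h).2 x

end
end FH


namespace FH
open Set Topology

lemma integrable_exp_neg_abs' : Integrable (fun x : ℝ => Real.exp (-|x|)) := by
  have h : IntegrableOn (fun x : ℝ => Real.exp (-x)) (Ioi 0) := integrableOn_exp_neg_Ioi 0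
  have h2 : IntegrableOn (fun x : ℝ => Real.exp x) (Iic 0) := integrableOn_exp_Iic 0
  rw [← integrableOn_univ, ← Iic_union_Ioi (a := (0:ℝ))]
  refine IntegrableOn.union (h2.congr_fun (fun x hx => ?_) measurableSet_Iic)
    (h.congr_fun (fun x hx => ?_) measurableSet_Ioi)
  · simp only [abs_of_nonpos (show x ≤ 0 from hx), neg_neg]
  · simp only [abs_of_pos (show 0 < x from hx)]

lemma poly_exp {C1 C2 K a b g x : ℝ} (h1 : |a| ≤ C1 * Real.exp (-|x|)) (h2 : |b| ≤ C2 * Real.exp (-|x|))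
    (h3 : |g| ≤ K * (1 + x ^ 2)) : |a * b * g| ≤ 2 * C1 * C2 * K * Real.exp (-|x|) := by
  have e := Real.quadratic_le_exp_of_nonneg (abs_nonneg x)
  rw [sq_abs] at e
  have p := Real.exp_pos (-|x|)
  have e1 : Real.exp (|x|) * Real.exp (-|x|) = 1 := by rw [← Real.exp_add]; simp
  have hC1 : 0 ≤ C1 * Real.exp (-|x|) := (abs_nonneg _).trans h1
  have hC2 : 0 ≤ C2 * Real.exp (-|x|) := (abs_nonneg _).trans h2
  have hK : 0 ≤ K := by
    by_contra hK; push Not at hK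
    have := (abs_nonneg _).trans h3
    nlinarith [sq_nonneg x]
  have h4 : 1 + x ^ 2 ≤ 2 * Real.exp |x| := by nlinarith [abs_nonneg x]
  rw [abs_mul, abs_mul]
  calc |a| * |b| * |g| ≤ (C1 * Real.exp (-|x|)) * (C2 * Real.exp (-|x|)) * (K * (2 * Real.exp |x|)) := by
        gcongr; exact h3.trans (by gcongr)
    _ = 2 * C1 * C2 * K * (Real.exp |x| * Real.exp (-|x|)) * Real.exp (-|x|) := by ring
    _ = _ := by rw [e1]; ring

lemma integrable_prod {s : Set ℝ} (hs : MeasurableSet s) {u v g : ℝ → ℝ} {C K : ℝ} (cu : Continuous u)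
    (cv : Continuous v) (cg : Continuous g) (bu : ∀ x ∈ s, |u x| ≤ C * Real.exp (-|x|))
    (bv : ∀ x ∈ s, |v x| ≤ C * Real.exp (-|x|)) (bg : ∀ x ∈ s, |g x| ≤ K * (1 + x ^ 2)) :
    IntegrableOn (fun x => u x * v x * g x) s := by
  refine Integrable.mono' (g := fun x => 2 * C * C * K * Real.exp (-|x|))
    (integrable_exp_neg_abs'.const_mul _).integrableOn (by fun_prop) ?_
  refine (ae_restrict_iff' hs).2 (Eventually.of_forall fun x hx => ?_)
  exact poly_exp (bu x hx) (bv x hx) (bg x hx)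

lemma dct {s : Set ℝ} (hs : MeasurableSet s) {us vs gs : ℕ → ℝ → ℝ} {u v g : ℝ → ℝ} {C K : ℝ}
    (cu : ∀ j, Continuous (us j)) (cv : ∀ j, Continuous (vs j)) (cg : ∀ j, Continuous (gs j))
    (tu : ∀ x ∈ s, Tendsto (fun j => us j x) atTop (𝓝 (u x)))
    (tv : ∀ x ∈ s, Tendsto (fun j => vs j x) atTop (𝓝 (v x)))
    (tg : ∀ x ∈ s, Tendsto (fun j => gs j x) atTop (𝓝 (g x)))
    (bu : ∀ᶠ j in atTop, ∀ x ∈ s, |us j x| ≤ C * Real.exp (-|x|))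
    (bv : ∀ᶠ j in atTop, ∀ x ∈ s, |vs j x| ≤ C * Real.exp (-|x|))
    (bg : ∀ᶠ j in atTop, ∀ x ∈ s, |gs j x| ≤ K * (1 + x ^ 2)) :
    Tendsto (fun j => ∫ x in s, us j x * vs j x * gs j x) atTop (𝓝 (∫ x in s, u x * v x * g x)) := by
  refine tendsto_integral_filter_of_dominated_convergence (fun x => 2 * C * C * K * Real.exp (-|x|)) ?_ ?_
    (integrable_exp_neg_abs'.const_mul _).integrableOn ?_
  · filter_upwards with j
    have := cu j; have := cv j; have := cg j
    fun_prop
  · filter_upwards [bu, bv, bg] with j h1 h2 h3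
    refine (ae_restrict_iff' hs).2 (Eventually.of_forall fun x hx => ?_)
    exact poly_exp (h1 x hx) (h2 x hx) (h3 x hx)
  · refine (ae_restrict_iff' hs).2 (Eventually.of_forall fun x hx => ?_)
    exact ((tu x hx).mul (tv x hx)).mul (tg x hx)

lemma QConv.bdd {qs : ℕ → ℝ → ℝ} {q : ℝ → ℝ} (hqc : Continuous q) (h : QConv qs q) {R : ℝ} (hR : 0 ≤ R) :
    ∃ Q, 0 ≤ Q ∧ (∀ᶠ j in atTop, ∀ x, |x| ≤ R → |qs j x| ≤ Q) ∧ ∀ x, |x| ≤ R → |q x| ≤ Q := by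
  obtain ⟨Q, hQ⟩ := (isCompact_Icc (a := -R) (b := R)).exists_bound_of_continuousOn hqc.continuousOn
  have hQ0 : 0 ≤ Q := (norm_nonneg _).trans (hQ 0 ⟨by linarith, hR⟩)
  have hq : ∀ x, |x| ≤ R → |q x| ≤ Q := fun x hx => hQ x (abs_le.1 hx)
  refine ⟨Q + 1, by linarith, ?_, fun x hx => by linarith [hq x hx]⟩
  filter_upwards [h R 1 one_pos] with j hj x hx
  have h1 := hj x hx
  have h2 := hq x hx
  calc |qs j x| = |(qs j x - q x) + q x| := by ring_nf
    _ ≤ _ := abs_add_le _ _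
    _ ≤ _ := by linarith

/-- Two-sided decaying normalized solution. -/
structure EF (R : ℝ) (q u w : ℝ → ℝ) : Prop where
  rt : RT R q u w
  left : Tame R (fun x => u (-x)) (fun x => -w (-x))

/-- The zero-energy operator has an `L²` kernel. -/
def Eig (q : ℝ → ℝ) : Prop := ∃ u w, Sol q u w ∧ Integrable (fun x => u x ^ 2) ∧ u ≠ 0

/-- Confinement outside `[-R, R]`. -/
def Conf (R : ℝ) (q : ℝ → ℝ) : Prop := ∀ x, R ≤ |x| → 1 ≤ q x

section
variable {q u w u' w' : ℝ → ℝ} {R : ℝ}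

lemma Conf.right (h : Conf R q) : ∀ x, R ≤ x → 1 ≤ q x := fun x hx => h x (hx.trans (le_abs_self x))
lemma Conf.neg (h : Conf R q) : Conf R (fun x => q (-x)) := fun x hx => h (-x) (by rwa [abs_neg])

lemma EF.bound (h : EF R q u w) (hR : 0 ≤ R) (hc : Conf R q) {Q : ℝ} (hQ0 : 0 ≤ Q)
    (hQ : ∀ x, |x| ≤ R → |q x| ≤ Q) (x : ℝ) :
    |u x| ≤ Real.exp ((2 + Q) * R) * Real.exp (-|x|) ∧ |w x| ≤ Real.exp ((2 + Q) * R) := by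
  rcases le_total 0 x with hx | hx
  · rw [abs_of_nonneg hx]
    exact tame_bound h.rt.sol hR hc.right h.rt.tame hQ0 (fun y hy => hQ y (by rw [abs_of_nonneg hy.1]; exact hy.2))
      h.rt.unit hx
  · rw [abs_of_nonpos hx]
    have := tame_bound h.rt.sol.neg hR hc.neg.right h.left hQ0 
      (fun y hy => hQ (-y) (by rw [abs_neg, abs_of_nonneg hy.1]; exact hy.2))
      (by simpa using h.rt.unit) (x := -x) (by linarith)
    simpa using this

lemma EF.exists_bound (h : EF R q u w) (hqc : Continuous q) (hR : 0 ≤ R) (hc : Conf R q) :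
    ∃ C, ∀ x, |u x| ≤ C * Real.exp (-|x|) ∧ |w x| ≤ C := by
  obtain ⟨Q, hQ0, _, hQ⟩ := (QConv.const q).bdd hqc hR
  exact ⟨_, h.bound hR hc hQ0 hQ⟩

lemma EF.eig (h : EF R q u w) (hqc : Continuous q) (hR : 0 ≤ R) (hc : Conf R q) : Eig q := by
  obtain ⟨C, hC⟩ := h.exists_bound hqc hR hc
  refine ⟨u, w, h.rt.sol, ?_, fun h0 => ?_⟩
  · have := integrable_prod (s := univ) MeasurableSet.univ h.rt.sol.contu h.rt.sol.contu continuous_const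
      (g := fun _ => 1) (K := 1) (fun x _ => (hC x).1) (fun x _ => (hC x).1)
      (fun x _ => by rw [abs_one]; nlinarith [sq_nonneg x])
    rw [integrableOn_univ] at this
    refine this.congr (Eventually.of_forall fun x => ?_)
    simp only; ring
  · have := h.rt.pos
    rw [h0] at this; simp at this

lemma exists_EF (hqc : Continuous q) (hc : Conf R q) (h : Sol q u w)
    (hi : Integrable (fun x => u x ^ 2)) (hne : u ≠ 0) :
    ∃ s : ℝ, s ≠ 0 ∧ EF R q (fun x => s * u x) (fun x => s * w x) := by
  have hp : 0 < u 0 ^ 2 + w 0 ^ 2 := by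
    by_contra hn
    push Not at hn
    have h1 : u 0 = 0 := by nlinarith [sq_nonneg (u 0), sq_nonneg (w 0)]
    have h2 : w 0 = 0 := by nlinarith [sq_nonneg (u 0), sq_nonneg (w 0)]
    have hzero : Sol q (0 : ℝ → ℝ) 0 := ⟨fun x => by simp, fun x => by simp⟩
    exact hne (h.unique hqc hzero (t := 0) (by simp [h1]) (by simp [h2])).1
  set n := Real.sqrt (u 0 ^ 2 + w 0 ^ 2) with hn
  have hn2 : n ^ 2 = u 0 ^ 2 + w 0 ^ 2 := Real.sq_sqrt hp.le
  have hn0 : 0 < n := Real.sqrt_pos.2 hp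
  have hright : Tame R (fun x => n⁻¹ * u x) (fun x => n⁻¹ * w x) :=
    tame_of_int (h.smul n⁻¹) hc.right (by simp only [mul_pow]; exact hi.const_mul _)
  obtain ⟨τ, hτ, hRT⟩ := sign_RT hqc hc.right (h.smul n⁻¹)
    (by simp only [mul_pow, ← mul_add, ← hn2]; field_simp) hright
  simp only [← mul_assoc] at hRT
  refine ⟨τ * n⁻¹, ?_, hRT, ?_⟩
  · rcases hτ with rfl | rfl <;> simp [hn0.ne']
  · exact tame_of_int hRT.sol.neg hc.neg.right (by
      simp only [mul_pow]; exact hi.comp_neg.const_mul _)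

lemma EF.lim {qs : ℕ → ℝ → ℝ} {us ws : ℕ → ℝ → ℝ} (hqc : Continuous q) (hc : Conf R q)
    (hQc : QConv qs q) (hs : ∀ j, EF R (qs j) (us j) (ws j)) :
    ∃ u w, EF R q u w ∧ ∀ x, Tendsto (fun j => us j x) atTop (𝓝 (u x)) := by
  obtain ⟨u, w, h⟩ := exists_RT hqc hc.right
  have hcv := RT.conv hqc hc.right hQc (fun j => (hs j).rt) h
  refine ⟨u, w, ⟨h, fun x hx => ?_⟩, fun x => (hcv x).1⟩
  exact le_of_tendsto' ((hcv (-x)).1.mul (hcv (-x)).2.neg) fun j => (hs j).left x hx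

lemma EF.unique (hqc : Continuous q) (hc : Conf R q) (h : EF R q u w) (h' : EF R q u' w') : u = u' :=
  (RT.unique hqc hc.right h.rt h'.rt).1

lemma wronsk {q q' : ℝ → ℝ} (h : Sol q u w) (h' : Sol q' u' w') (x : ℝ) :
    HasDerivAt (fun x => u x * w' x - u' x * w x) (u x * u' x * (q' x - q x)) x := by
  convert! ((h.hu x).mul (h'.hw x)).sub ((h'.hu x).mul (h.hw x)) using 1; ring

lemma wr_le {a b c d C x : ℝ} (h1 : |a| ≤ C * Real.exp (-|x|)) (h2 : |b| ≤ C * Real.exp (-|x|)) (h3 : |c| ≤ C)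
    (h4 : |d| ≤ C) : ‖a * c - b * d‖ ≤ 2 * C ^ 2 * Real.exp (-|x|) := by
  have hC : 0 ≤ C := (abs_nonneg _).trans h3
  rw [Real.norm_eq_abs]
  calc |a * c - b * d| ≤ |a * c| + |b * d| := abs_sub _ _
    _ = |a| * |c| + |b| * |d| := by rw [abs_mul, abs_mul]
    _ ≤ C * Real.exp (-|x|) * C + C * Real.exp (-|x|) * C := by gcongr
    _ = _ := by ring

lemma tendsto_exp_neg_abs_top : Tendsto (fun x : ℝ => Real.exp (-|x|)) atTop (𝓝 0) :=
  Real.tendsto_exp_neg_atTop_nhds_zero.comp tendsto_abs_atTop_atTop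
lemma tendsto_exp_neg_abs_bot : Tendsto (fun x : ℝ => Real.exp (-|x|)) atBot (𝓝 0) :=
  Real.tendsto_exp_neg_atTop_nhds_zero.comp tendsto_abs_atBot_atTop

lemma EF.ident {q' : ℝ → ℝ} {K : ℝ} (hR : 0 ≤ R) (hqc : Continuous q) (hqc' : Continuous q') (hc : Conf R q)
    (hc' : Conf R q') (h : EF R q u w) (h' : EF R q' u' w') (hK : ∀ x, |q' x - q x| ≤ K * (1 + x ^ 2)) :
    ∫ x, u x * u' x * (q' x - q x) = 0 := by
  obtain ⟨C1, hC1⟩ := h.exists_bound hqc hR hc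
  obtain ⟨C2, hC2⟩ := h'.exists_bound hqc' hR hc'
  set C := max C1 C2
  have b1 : ∀ x, |u x| ≤ C * Real.exp (-|x|) := fun x => (hC1 x).1.trans (by gcongr; exact le_max_left _ _)
  have b2 : ∀ x, |u' x| ≤ C * Real.exp (-|x|) := fun x => (hC2 x).1.trans (by gcongr; exact le_max_right _ _)
  have b3 : ∀ x, |w x| ≤ C := fun x => (hC1 x).2.trans (le_max_left _ _)
  have b4 : ∀ x, |w' x| ≤ C := fun x => (hC2 x).2.trans (le_max_right _ _)
  have hIntg : Integrable (fun x => u x * u' x * (q' x - q x)) := by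
    rw [← integrableOn_univ]
    exact integrable_prod MeasurableSet.univ h.rt.sol.contu h'.rt.sol.contu (by fun_prop) (fun x _ => b1 x) (fun x _ => b2 x)
      (fun x _ => hK x)
  have hb : ∀ x, ‖u x * w' x - u' x * w x‖ ≤ 2 * C ^ 2 * Real.exp (-|x|) := fun x => wr_le (b1 x) (b2 x) (b4 x) (b3 x)
  have := integral_of_hasDerivAt_of_tendsto (wronsk h.rt.sol h'.rt.sol) hIntg (m := 0) (n := 0)
    (squeeze_zero_norm hb (by simpa using tendsto_exp_neg_abs_bot.const_mul (2 * C ^ 2)))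
    (squeeze_zero_norm hb (by simpa using tendsto_exp_neg_abs_top.const_mul (2 * C ^ 2)))
  simpa using this

lemma RT.ident {μ ν C : ℝ} {V : ℝ → ℝ} (h : RT R (fun x => V x - μ) u w) (h' : RT R (fun x => V x - ν) u' w')
    (b1 : ∀ x, 0 ≤ x → |u x| ≤ C * Real.exp (-|x|) ∧ |w x| ≤ C)
    (b2 : ∀ x, 0 ≤ x → |u' x| ≤ C * Real.exp (-|x|) ∧ |w' x| ≤ C) :
    u' 0 * w 0 - u 0 * w' 0 = (μ - ν) * ∫ x in Ioi 0, u x * u' x * 1 := by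
  have hIntg : IntegrableOn (fun x => u x * u' x * (V x - ν - (V x - μ))) (Ioi 0) := by
    have := integrable_prod (s := Ioi 0) measurableSet_Ioi h.sol.contu h'.sol.contu (g := fun _ => μ - ν) (by fun_prop)
      (K := |μ - ν|) (fun x hx => (b1 x (le_of_lt hx)).1) (fun x hx => (b2 x (le_of_lt hx)).1)
      (fun x _ => by nlinarith [sq_nonneg x, abs_nonneg (μ - ν)])
    refine this.congr_fun (fun x _ => ?_) measurableSet_Ioi
    simp only; ring
  have hb : ∀ᶠ x in atTop, ‖u x * w' x - u' x * w x‖ ≤ 2 * C ^ 2 * Real.exp (-|x|) := by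
    filter_upwards [eventually_ge_atTop 0] with x hx
    exact wr_le (b1 x hx).1 (b2 x hx).1 (b2 x hx).2 (b1 x hx).2
  have := integral_Ioi_of_hasDerivAt_of_tendsto' (fun x _ => wronsk h.sol h'.sol x) hIntg (m := 0)
    (squeeze_zero_norm' hb (by simpa using tendsto_exp_neg_abs_top.const_mul (2 * C ^ 2)))
  rw [← integral_const_mul]
  rw [zero_sub, neg_sub] at this
  rw [← this]
  refine integral_congr_ae (Eventually.of_forall fun x => ?_)
  simp only; ring

lemma int_pos {s : Set ℝ} (hs : IsOpen s) (hu : Continuous u) (hRs : R ∈ s) (hne : u R ≠ 0)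
    (hi : IntegrableOn (fun x => u x * u x * 1) s) : 0 < ∫ x in s, u x * u x * 1 := by
  rw [integral_pos_iff_support_of_nonneg (fun x => by simpa using mul_self_nonneg (u x)) hi]
  have : IsOpen (Function.support (fun x => u x * u x * 1)) := by
    apply IsOpen.preimage (t := {0}ᶜ) (by fun_prop) isOpen_compl_singleton
  rw [Measure.restrict_apply this.measurableSet]
  exact (this.inter hs).measure_pos _ ⟨R, by simpa using hne, hRs⟩

end
end FH


namespace FH
open Set Topology

section
variable {q u w u' w' : ℝ → ℝ} {R : ℝ}

lemma EF.seq_bound {qs us ws : ℕ → ℝ → ℝ} (hR : 0 ≤ R) (hqc : Continuous q) (hcs : ∀ j, Conf R (qs j))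
    (hQ : QConv qs q) (hs : ∀ j, EF R (qs j) (us j) (ws j)) :
    ∃ C, ∀ᶠ j in atTop, ∀ x, |us j x| ≤ C * Real.exp (-|x|) := by
  obtain ⟨Q, hQ0, hQe, _⟩ := hQ.bdd hqc hR
  refine ⟨Real.exp ((2 + Q) * R), ?_⟩
  filter_upwards [hQe] with j hj x
  exact ((hs j).bound hR (hcs j) hQ0 hj x).1

lemma pair_tendsto {qs qs' us ws us' ws' gs : ℕ → ℝ → ℝ} {g : ℝ → ℝ} {K : ℝ} (hR : 0 ≤ R)
    (hqc : Continuous q) (hc : Conf R q) (hcs : ∀ j, Conf R (qs j)) (hcs' : ∀ j, Conf R (qs' j))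
    (hQ : QConv qs q) (hQ' : QConv qs' q) (hs : ∀ j, EF R (qs j) (us j) (ws j))
    (hs' : ∀ j, EF R (qs' j) (us' j) (ws' j)) (h : EF R q u w) (cg : ∀ j, Continuous (gs j))
    (tg : ∀ x, Tendsto (fun j => gs j x) atTop (𝓝 (g x))) (bg : ∀ j x, |gs j x| ≤ K * (1 + x ^ 2)) :
    Tendsto (fun j => ∫ x, us j x * us' j x * gs j x) atTop (𝓝 (∫ x, u x * u x * g x)) := by
  obtain ⟨u1, w1, h1, t1⟩ := EF.lim hqc hc hQ hs
  obtain ⟨u2, w2, h2, t2⟩ := EF.lim hqc hc hQ' hs'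
  obtain rfl := EF.unique hqc hc h h1
  obtain rfl := EF.unique hqc hc h h2
  obtain ⟨C1, b1⟩ := EF.seq_bound hR hqc hcs hQ hs
  obtain ⟨C2, b2⟩ := EF.seq_bound hR hqc hcs' hQ' hs'
  have := dct (s := univ) MeasurableSet.univ (C := max C1 C2) (fun j => (hs j).rt.sol.contu)
    (fun j => (hs' j).rt.sol.contu) cg (fun x _ => t1 x) (fun x _ => t2 x) (fun x _ => tg x) ?_ ?_
    (Eventually.of_forall fun j x _ => bg j x)
  · simpa using this
  · filter_upwards [b1] with j hj x _
    exact (hj x).trans (by gcongr; exact le_max_left _ _)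
  · filter_upwards [b2] with j hj x _
    exact (hj x).trans (by gcongr; exact le_max_right _ _)

lemma one_le_poly (x : ℝ) : |(1:ℝ)| ≤ 1 * (1 + x ^ 2) := by
  rw [abs_one]; nlinarith [sq_nonneg x]

lemma EF.int_pos (h : EF R q u w) (hqc : Continuous q) (hR : 0 ≤ R) (hc : Conf R q) :
    0 < ∫ x, u x * u x * 1 := by
  obtain ⟨C, hC⟩ := h.exists_bound hqc hR hc
  have := FH.int_pos (s := univ) isOpen_univ h.rt.sol.contu (mem_univ R) h.rt.pos.ne'
    (integrable_prod MeasurableSet.univ h.rt.sol.contu h.rt.sol.contu continuous_const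
      (fun x _ => (hC x).1) (fun x _ => (hC x).1) (fun x _ => one_le_poly x))
  simpa using this
end

/-- A family of confining potentials, Lipschitz at `ξ0`. -/
structure Fam (V : ℝ → ℝ → ℝ) (ξ0 L : ℝ) : Prop where
  cont : ∀ ξ, Continuous (V ξ)
  nonneg : ∀ ξ x, 0 ≤ V ξ x
  lip : ∀ ξ x, |V ξ x - V ξ0 x| ≤ L * |ξ - ξ0| * (1 + x ^ 2)
  coer : ∀ Λ : ℝ, ∃ R > 0, ∀ ξ x, R ≤ |x| → Λ ≤ V ξ x

section
variable {V : ℝ → ℝ → ℝ} {ξ0 L : ℝ}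

lemma Fam.conf (hV : Fam V ξ0 L) (μ : ℝ) :
    ∃ R > 0, ∀ ξ μ', |μ' - μ| ≤ 1 → Conf R (fun x => V ξ x - μ') := by
  obtain ⟨R, hR, h⟩ := hV.coer (μ + 2)
  refine ⟨R, hR, fun ξ μ' hμ x hx => ?_⟩
  have := h ξ x hx
  have := (abs_le.1 hμ).2
  linarith

lemma Fam.contq (hV : Fam V ξ0 L) (ξ μ : ℝ) : Continuous (fun x => V ξ x - μ) :=
  (hV.cont ξ).sub continuous_const

lemma Fam.qconv (hV : Fam V ξ0 L) {ξs μs : ℕ → ℝ} {μ : ℝ} (hξ : Tendsto ξs atTop (𝓝 ξ0))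
    (hμ : Tendsto μs atTop (𝓝 μ)) : QConv (fun j x => V (ξs j) x - μs j) (fun x => V ξ0 x - μ) := by
  intro T η hη
  have h1 : Tendsto (fun j => |L| * |ξs j - ξ0| * (1 + T ^ 2) + |μs j - μ|) atTop (𝓝 0) := by
    have e1 : Tendsto (fun j => |ξs j - ξ0|) atTop (𝓝 0) := by
      simpa using (hξ.sub_const ξ0).abs
    have e2 : Tendsto (fun j => |μs j - μ|) atTop (𝓝 0) := by
      simpa using (hμ.sub_const μ).abs
    simpa using ((e1.const_mul |L|).mul_const (1 + T ^ 2)).add e2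
  filter_upwards [h1.eventually (gt_mem_nhds hη)] with j hj x hx
  have h2 := hV.lip (ξs j) x
  have h3 : x ^ 2 ≤ T ^ 2 := by rw [← sq_abs]; gcongr
  calc |V (ξs j) x - μs j - (V ξ0 x - μ)| = |(V (ξs j) x - V ξ0 x) - (μs j - μ)| := by ring_nf
    _ ≤ |V (ξs j) x - V ξ0 x| + |μs j - μ| := abs_sub _ _
    _ ≤ L * |ξs j - ξ0| * (1 + x ^ 2) + |μs j - μ| := by gcongr
    _ ≤ |L| * |ξs j - ξ0| * (1 + T ^ 2) + |μs j - μ| := by gcongr; exact le_abs_self L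
    _ ≤ η := hj.le

lemma qconv_const (v : ℝ → ℝ) {μs : ℕ → ℝ} {μ : ℝ} (hμ : Tendsto μs atTop (𝓝 μ)) :
    QConv (fun j x => v x - μs j) (fun x => v x - μ) := by
  intro T η hη
  have e2 : Tendsto (fun j => |μs j - μ|) atTop (𝓝 0) := by
    simpa using (hμ.sub_const μ).abs
  filter_upwards [e2.eventually (gt_mem_nhds hη)] with j hj x _
  rw [show v x - μs j - (v x - μ) = -(μs j - μ) by ring, abs_neg]
  exact hj.le

lemma Fam.lower (hV : Fam V ξ0 L) {ξ μ : ℝ} (h : Eig (fun x => V ξ x - μ)) : -1 < μ := by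
  by_contra hn
  push Not at hn
  obtain ⟨u, w, hs, hi, hne⟩ := h
  have hq : ∀ x, (0:ℝ) ≤ x → 1 ≤ V ξ x - μ := fun x _ => by have := hV.nonneg ξ x; linarith
  have hq' : ∀ x, (0:ℝ) ≤ x → 1 ≤ V ξ (-x) - μ := fun x _ => by have := hV.nonneg ξ (-x); linarith
  have t1 := tame_of_int hs hq hi 0 le_rfl
  have t2 := tame_of_int hs.neg hq' hi.comp_neg 0 le_rfl
  simp only [neg_zero] at t2
  exact hne (tame_zero (hV.contq ξ μ) hs hq (tame_of_int hs hq hi) (by linarith)).1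

lemma Fam.closed (hV : Fam V ξ0 L) {ξs μs : ℕ → ℝ} {μ : ℝ} (hξ : Tendsto ξs atTop (𝓝 ξ0))
    (hμ : Tendsto μs atTop (𝓝 μ)) (hb : ∀ j, |μs j - μ| ≤ 1) (hE : ∀ j, Eig (fun x => V (ξs j) x - μs j)) :
    Eig (fun x => V ξ0 x - μ) := by
  obtain ⟨R, hR, hc⟩ := hV.conf μ
  have : ∀ j, ∃ u w, EF R (fun x => V (ξs j) x - μs j) u w := by
    intro j
    obtain ⟨u, w, h, hi, hne⟩ := hE j
    obtain ⟨s, _, h⟩ := exists_EF (hV.contq _ _) (hc (ξs j) (μs j) (hb j)) h hi hne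
    exact ⟨_, _, h⟩
  choose us ws hs using this
  obtain ⟨u, w, h, _⟩ := EF.lim (hV.contq ξ0 μ) (hc ξ0 μ (by simp)) (hV.qconv hξ hμ) hs
  exact h.eig (hV.contq ξ0 μ) hR.le (hc ξ0 μ (by simp))

lemma Fam.single (hV : Fam V ξ0 L) {ξs μs μs' : ℕ → ℝ} {μ : ℝ} (hξ : Tendsto ξs atTop (𝓝 ξ0))
    (hμ : Tendsto μs atTop (𝓝 μ)) (hμ' : Tendsto μs' atTop (𝓝 μ)) (hb : ∀ j, |μs j - μ| ≤ 1)
    (hb' : ∀ j, |μs' j - μ| ≤ 1) (hE : ∀ j, Eig (fun x => V (ξs j) x - μs j))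
    (hE' : ∀ j, Eig (fun x => V (ξs j) x - μs' j)) (hne : ∀ j, μs j ≠ μs' j) : False := by
  obtain ⟨R, hR, hc⟩ := hV.conf μ
  have hex : ∀ j μ', |μ' - μ| ≤ 1 → Eig (fun x => V (ξs j) x - μ') →
      ∃ u w, EF R (fun x => V (ξs j) x - μ') u w := by
    intro j μ' hb hE
    obtain ⟨u, w, h, hi, hne⟩ := hE
    obtain ⟨s, _, h⟩ := exists_EF (hV.contq _ _) (hc (ξs j) μ' hb) h hi hne
    exact ⟨_, _, h⟩
  choose us ws hs using fun j => hex j (μs j) (hb j) (hE j)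
  choose us' ws' hs' using fun j => hex j (μs' j) (hb' j) (hE' j)
  have hc0 := hc ξ0 μ (by simp)
  obtain ⟨u, w, h, _⟩ := EF.lim (hV.contq ξ0 μ) hc0 (hV.qconv hξ hμ) hs
  have ht := pair_tendsto (gs := fun _ _ => 1) (g := fun _ => 1) hR.le (hV.contq ξ0 μ) hc0
    (fun j => hc (ξs j) (μs j) (hb j)) (fun j => hc (ξs j) (μs' j) (hb' j)) (hV.qconv hξ hμ)
    (hV.qconv hξ hμ') hs hs' h (fun _ => continuous_const) (fun _ => tendsto_const_nhds)
    (fun _ x => one_le_poly x)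
  have hz : ∀ j, ∫ x, us j x * us' j x * 1 = 0 := by
    intro j
    have := EF.ident (K := |μs j - μs' j|) hR.le (hV.contq _ _) (hV.contq _ _) (hc (ξs j) (μs j) (hb j))
      (hc (ξs j) (μs' j) (hb' j)) (hs j) (hs' j) (fun x => by
        rw [show V (ξs j) x - μs' j - (V (ξs j) x - μs j) = μs j - μs' j by ring]
        nlinarith [abs_nonneg (μs j - μs' j), sq_nonneg x])
    have e : (fun x => us j x * us' j x * (V (ξs j) x - μs' j - (V (ξs j) x - μs j)))
        = fun x => (μs j - μs' j) * (us j x * us' j x * 1) := by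
      funext x; ring
    rw [e, integral_const_mul] at this
    exact (mul_eq_zero.1 this).resolve_left (sub_ne_zero.2 (hne j))
  simp only [hz] at ht
  have := tendsto_nhds_unique ht tendsto_const_nhds
  exact (h.int_pos (hV.contq ξ0 μ) hR.le hc0).ne' this

lemma Fam.slope (hV : Fam V ξ0 L) {ξs μs : ℕ → ℝ} {μ : ℝ} (hξ : Tendsto ξs atTop (𝓝 ξ0))
    (hξne : ∀ j, ξs j ≠ ξ0)
    (hμ : Tendsto μs atTop (𝓝 μ)) (hb : ∀ j, |μs j - μ| ≤ 1) (hE : ∀ j, Eig (fun x => V (ξs j) x - μs j))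
    {H0 W0 D : ℝ → ℝ} (hS : Sol (fun x => V ξ0 x - μ) H0 W0) (hi : Integrable (fun x => H0 x ^ 2))
    (hn : ∫ x, H0 x ^ 2 = 1) (hD : ∀ x, HasDerivAt (fun ξ => V ξ x) (D x) ξ0) :
    Tendsto (fun j => (μs j - μ) / (ξs j - ξ0)) atTop (𝓝 (∫ x, D x * H0 x ^ 2)) := by
  obtain ⟨R, hR, hc⟩ := hV.conf μ
  have : ∀ j, ∃ u w, EF R (fun x => V (ξs j) x - μs j) u w := by
    intro j
    obtain ⟨u, w, h, hi, hne⟩ := hE j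
    obtain ⟨s, _, h⟩ := exists_EF (hV.contq _ _) (hc (ξs j) (μs j) (hb j)) h hi hne
    exact ⟨_, _, h⟩
  choose us ws hs using this
  have hc0 := hc ξ0 μ (by simp)
  have hne : H0 ≠ 0 := by
    rintro rfl
    simp at hn
  obtain ⟨s, hs0, h⟩ := exists_EF (hV.contq _ _) hc0 hS hi hne
  have hds : ∀ j, ξs j - ξ0 ≠ 0 := fun j => sub_ne_zero.2 (hξne j)
  have t1 := pair_tendsto (gs := fun _ _ => 1) (g := fun _ => 1) hR.le (hV.contq ξ0 μ) hc0
    (fun j => hc (ξs j) (μs j) (hb j)) (fun j => hc0) (hV.qconv hξ hμ)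
    (QConv.const _) hs (fun _ => h) h (fun _ => continuous_const) (fun _ => tendsto_const_nhds)
    (fun _ x => one_le_poly x)
  have t2 := pair_tendsto (gs := fun j x => (V (ξs j) x - V ξ0 x) / (ξs j - ξ0)) (g := D) (K := L) hR.le
    (hV.contq ξ0 μ) hc0
    (fun j => hc (ξs j) (μs j) (hb j)) (fun j => hc0) (hV.qconv hξ hμ)
    (QConv.const _) hs (fun _ => h) h
    (fun j => ((hV.cont _).sub (hV.cont _)).div_const _) (fun x => by
      have := (hasDerivAt_iff_tendsto_slope.1 (hD x)).comp
        (tendsto_nhdsWithin_iff.2 ⟨hξ, Eventually.of_forall hξne⟩)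
      refine this.congr fun j => ?_
      simp [slope_def_field])
    (fun j x => by
      rw [abs_div, div_le_iff₀ (abs_pos.2 (hds j))]
      have := hV.lip (ξs j) x
      linarith)
  have hid : ∀ j, (μs j - μ) / (ξs j - ξ0) * (∫ x, us j x * (s * H0 x) * 1) =
      ∫ x, us j x * (s * H0 x) * ((V (ξs j) x - V ξ0 x) / (ξs j - ξ0)) := by
    intro j
    obtain ⟨C1, hC1⟩ := (hs j).exists_bound (hV.contq _ _) hR.le (hc _ _ (hb j))
    obtain ⟨C2, hC2⟩ := h.exists_bound (hV.contq _ _) hR.le hc0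
    have b1 : ∀ x ∈ univ, |us j x| ≤ max C1 C2 * Real.exp (-|x|) := fun x _ =>
      (hC1 x).1.trans (by gcongr; exact le_max_left _ _)
    have b2 : ∀ x ∈ univ, |s * H0 x| ≤ max C1 C2 * Real.exp (-|x|) := fun x _ =>
      (hC2 x).1.trans (by gcongr; exact le_max_right _ _)
    have i1 := integrable_prod MeasurableSet.univ (hs j).rt.sol.contu h.rt.sol.contu continuous_const b1 b2
      (fun x _ => one_le_poly x)
    have i2 := integrable_prod MeasurableSet.univ (hs j).rt.sol.contu h.rt.sol.contu
      ((hV.cont (ξs j)).sub (hV.cont ξ0)) b1 b2 (fun x _ => hV.lip (ξs j) x)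
    rw [integrableOn_univ] at i1 i2
    simp only [Pi.sub_apply] at i2
    have id := EF.ident (K := L * |ξs j - ξ0| + |μs j - μ|) hR.le (hV.contq _ _) (hV.contq _ _)
      (hc (ξs j) (μs j) (hb j)) hc0 (hs j) h (fun x => by
        have h1 := hV.lip (ξs j) x
        calc |V ξ0 x - μ - (V (ξs j) x - μs j)| = |(μs j - μ) - (V (ξs j) x - V ξ0 x)| := by ring_nf
          _ ≤ |μs j - μ| + |V (ξs j) x - V ξ0 x| := abs_sub _ _
          _ ≤ _ := by nlinarith [abs_nonneg (μs j - μ), sq_nonneg x])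
    have e : (fun x => us j x * (s * H0 x) * (V ξ0 x - μ - (V (ξs j) x - μs j)))
        = fun x => (μs j - μ) * (us j x * (s * H0 x) * 1) - us j x * (s * H0 x) * (V (ξs j) x - V ξ0 x) := by
      funext x; ring
    rw [e, integral_sub (i1.const_mul _) i2, integral_const_mul, sub_eq_zero] at id
    have e2 : (fun x => us j x * (s * H0 x) * ((V (ξs j) x - V ξ0 x) / (ξs j - ξ0)))
        = fun x => (ξs j - ξ0)⁻¹ * (us j x * (s * H0 x) * (V (ξs j) x - V ξ0 x)) := by
      funext x; ring
    rw [e2, integral_const_mul, ← id]; ring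
  have hp := h.int_pos (hV.contq ξ0 μ) hR.le hc0
  have t3 := t2.div t1 hp.ne'
  have hlim : (∫ x, s * H0 x * (s * H0 x) * D x) / (∫ x, s * H0 x * (s * H0 x) * 1)
      = ∫ x, D x * H0 x ^ 2 := by
    have e1 : (fun x => s * H0 x * (s * H0 x) * D x) = fun x => s ^ 2 * (D x * H0 x ^ 2) := by
      funext x; ring
    have e2 : (fun x => s * H0 x * (s * H0 x) * 1) = fun x => s ^ 2 * (H0 x ^ 2) := by
      funext x; ring
    rw [e1, e2, integral_const_mul, integral_const_mul, hn]
    field_simp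
  rw [hlim] at t3
  refine t3.congr' ?_
  filter_upwards [t1.eventually (lt_mem_nhds hp)] with j hj
  rw [Pi.div_apply, ← hid j, mul_div_cancel_right₀ _ hj.ne']
end
end FH


namespace FH
open Set Topology

lemma RT.bound {q u w : ℝ → ℝ} {R Q : ℝ} (h : RT R q u w) (hR : 0 ≤ R) (hq : ∀ x, R ≤ x → 1 ≤ q x)
    (hQ0 : 0 ≤ Q) (hQ : ∀ x, |x| ≤ R → |q x| ≤ Q) : ∀ x, 0 ≤ x →
    |u x| ≤ Real.exp ((2 + Q) * R) * Real.exp (-|x|) ∧ |w x| ≤ Real.exp ((2 + Q) * R) := by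
  intro x hx
  rw [abs_of_nonneg hx]
  exact tame_bound h.sol hR hq h.tame hQ0 (fun y hy => hQ y (by rw [abs_of_nonneg hy.1]; exact hy.2))
    h.unit hx

lemma RT.seq {v u w : ℝ → ℝ} {us ws : ℕ → ℝ → ℝ} {R ν : ℝ} {μs : ℕ → ℝ} (hR : 0 < R) (hv : Continuous v)
    (hq : ∀ x, R ≤ x → 1 ≤ v x - ν) (hqs : ∀ j, ∀ x, R ≤ x → 1 ≤ v x - μs j)
    (hμ : Tendsto μs atTop (𝓝 ν))
    (hs : ∀ j, RT R (fun x => v x - μs j) (us j) (ws j)) (h : RT R (fun x => v x - ν) u w) :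
    ∃ Is : ℕ → ℝ, ∃ I > 0, Tendsto Is atTop (𝓝 I) ∧
      ∀ᶠ j in atTop, u 0 * ws j 0 - us j 0 * w 0 = (μs j - ν) * Is j := by
  have hqc : Continuous (fun x => v x - ν) := hv.sub continuous_const
  have hQc := qconv_const v hμ
  obtain ⟨Q, hQ0, hQe, hQ⟩ := hQc.bdd hqc hR.le
  have hcv := RT.conv hqc hq hQc hs h
  have b := h.bound hR.le hq hQ0 hQ
  have bs : ∀ᶠ j in atTop, ∀ x, 0 ≤ x →
    |us j x| ≤ Real.exp ((2 + Q) * R) * Real.exp (-|x|) ∧ |ws j x| ≤ Real.exp ((2 + Q) * R) := by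
    filter_upwards [hQe] with j hj
    exact (hs j).bound hR.le (hqs j) hQ0 hj
  refine ⟨fun j => ∫ x in Ioi 0, us j x * u x * 1, ∫ x in Ioi 0, u x * u x * 1, ?_, ?_, ?_⟩
  · refine int_pos (R := R) isOpen_Ioi h.sol.contu hR h.pos.ne' ?_
    exact integrable_prod measurableSet_Ioi h.sol.contu h.sol.contu continuous_const
      (fun x hx => (b x (le_of_lt hx)).1) (fun x hx => (b x (le_of_lt hx)).1) (fun x _ => one_le_poly x)
  · refine dct (C := Real.exp ((2 + Q) * R)) (K := 1) measurableSet_Ioi (fun j => (hs j).sol.contu) (fun _ => h.sol.contu)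
      (fun _ => continuous_const) (fun x _ => (hcv x).1) (fun x _ => tendsto_const_nhds)
      (fun x _ => tendsto_const_nhds) ?_ ?_ ?_
    · filter_upwards [bs] with j hj x hx
      exact (hj x (le_of_lt hx)).1
    · filter_upwards with j x hx
      exact (b x (le_of_lt hx)).1
    · filter_upwards with j x hx
      exact one_le_poly x
  · filter_upwards [bs] with j hj
    exact RT.ident (hs j) h hj b

lemma alg_G {a c a' c' a0 c0 a0' c0' δ I I' : ℝ} (h1 : a0 ^ 2 + c0 ^ 2 = 1) (h2 : a0' ^ 2 + c0' ^ 2 = 1)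
    (h0 : a0 * c0' + c0 * a0' = 0) (hI : a0 * c - a * c0 = δ * I) (hI' : a0' * c' - a' * c0' = δ * I') :
    (a0 * a0' - c0 * c0') * (a * c' + c * a') = 
      δ * ((a * a0 + c * c0) * I' + (a' * a0' + c' * c0') * I) := by
  have ea : a = (a * a0 + c * c0) * a0 - δ * I * c0 := by rw [← hI]; linear_combination (-a) * h1
  have ec : c = (a * a0 + c * c0) * c0 + δ * I * a0 := by rw [← hI]; linear_combination (-c) * h1
  have ea' : a' = (a' * a0' + c' * c0') * a0' - δ * I' * c0' := by rw [← hI']; linear_combination (-a') * h2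
  have ec' : c' = (a' * a0' + c' * c0') * c0' + δ * I' * a0' := by rw [← hI']; linear_combination (-c') * h2
  have ht : (a0 * a0' - c0 * c0') ^ 2 = 1 := by
    linear_combination h1 * (a0' ^ 2 + c0' ^ 2) + h2 - h0 * (a0 * c0' + c0 * a0')
  generalize (a * a0 + c * c0) = α at *
  generalize (a' * a0' + c' * c0') = α' at *
  have e : a * c' + c * a' = δ * (a0 * a0' - c0 * c0') * (α * I' + α' * I) := by
    rw [ea, ec, ea', ec']
    linear_combination (α * α' - δ ^ 2 * I * I') * h0
  rw [e]
  linear_combination (δ * (α * I' + α' * I)) * ht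

section
variable {V : ℝ → ℝ → ℝ} {ξ0 L : ℝ}

lemma Eig.of_match {q up wp um wm : ℝ → ℝ} {R : ℝ} (hR : 0 ≤ R) (hqc : Continuous q) (hc : Conf R q)
    (hp : RT R q up wp) (hm : RT R (fun x => q (-x)) um wm) (h0 : up 0 * wm 0 + wp 0 * um 0 = 0) : Eig q := by
  set t := up 0 * um 0 - wp 0 * wm 0 with ht
  have hneg : Sol q (fun x => um (-x)) (fun x => -wm (-x)) := by simpa using hm.sol.neg
  have e := hp.sol.unique hqc (hneg.smul t) (t := 0)
    (by simp only [neg_zero, ht]; linear_combination (-up 0) * hm.unit + wm 0 * h0)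
    (by simp only [neg_zero, ht]; linear_combination (-wp 0) * hm.unit + um 0 * h0)
  refine EF.eig (u := up) (w := wp) ⟨hp, fun x hx => ?_⟩ hqc hR hc
  have := hm.tame x hx
  simp only [e.1, e.2, neg_neg]
  nlinarith [sq_nonneg t]

lemma Fam.exists_eig (hV : Fam V ξ0 L) {ν : ℝ} (hE : Eig (fun x => V ξ0 x - ν)) {ε : ℝ} (hε : 0 < ε) :
    ∃ δ > 0, ∀ ξ, |ξ - ξ0| < δ → ∃ μ, |μ - ν| < ε ∧ Eig (fun x => V ξ x - μ) := by
  obtain ⟨R, hR, hc⟩ := hV.conf ν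
  have hexp : ∀ ξ μ, ∃ u w, |μ - ν| ≤ 1 → RT R (fun x => V ξ x - μ) u w := by
    intro ξ μ
    by_cases h : |μ - ν| ≤ 1
    · obtain ⟨u, w, h⟩ := exists_RT (hV.contq ξ μ) (hc ξ μ h).right
      exact ⟨u, w, fun _ => h⟩
    · exact ⟨0, 0, fun h' => absurd h' h⟩
  have hexm : ∀ ξ μ, ∃ u w, |μ - ν| ≤ 1 → RT R (fun x => V ξ (-x) - μ) u w := by
    intro ξ μ
    by_cases h : |μ - ν| ≤ 1
    · obtain ⟨u, w, h⟩ := exists_RT ((hV.contq ξ μ).comp continuous_neg) (hc ξ μ h).neg.right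
      exact ⟨u, w, fun _ => h⟩
    · exact ⟨0, 0, fun h' => absurd h' h⟩
  choose up wp hp using hexp
  choose um wm hm using hexm
  set G : ℝ → ℝ → ℝ := fun ξ μ => up ξ μ 0 * wm ξ μ 0 + wp ξ μ 0 * um ξ μ 0 with hG
  have hνν : |ν - ν| ≤ 1 := by simp
  have hGE : ∀ ξ μ, |μ - ν| ≤ 1 → G ξ μ = 0 → Eig (fun x => V ξ x - μ) := fun ξ μ hμ h0 =>
    Eig.of_match hR.le (hV.contq ξ μ) (hc ξ μ hμ) (hp ξ μ hμ) (hm ξ μ hμ) h0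
  have hGc : ∀ (ξs μs : ℕ → ℝ) (ξ μ : ℝ), (∀ j, |μs j - ν| ≤ 1) → |μ - ν| ≤ 1 →
      QConv (fun j x => V (ξs j) x - μs j) (fun x => V ξ x - μ) →
      (Tendsto (fun j => up (ξs j) (μs j) 0) atTop (𝓝 (up ξ μ 0)) ∧
       Tendsto (fun j => wp (ξs j) (μs j) 0) atTop (𝓝 (wp ξ μ 0)) ∧
       Tendsto (fun j => um (ξs j) (μs j) 0) atTop (𝓝 (um ξ μ 0)) ∧
       Tendsto (fun j => wm (ξs j) (μs j) 0) atTop (𝓝 (wm ξ μ 0))) := by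
    intro ξs μs ξ μ hs h hQ
    have h1 := RT.conv0 (hV.contq ξ μ) (hc ξ μ h).right hQ (fun j => hp _ _ (hs j)) (hp ξ μ h)
    have h2 := RT.conv0 ((hV.contq ξ μ).comp continuous_neg) (hc ξ μ h).neg.right hQ.neg
      (fun j => hm _ _ (hs j)) (hm ξ μ h)
    exact ⟨h1.1, h1.2, h2.1, h2.2⟩
  have hGt : ∀ (ξs μs : ℕ → ℝ) (ξ μ : ℝ), (∀ j, |μs j - ν| ≤ 1) → |μ - ν| ≤ 1 →
      QConv (fun j x => V (ξs j) x - μs j) (fun x => V ξ x - μ) →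
      Tendsto (fun j => G (ξs j) (μs j)) atTop (𝓝 (G ξ μ)) := by
    intro ξs μs ξ μ hs h hQ
    obtain ⟨h1, h2, h3, h4⟩ := hGc ξs μs ξ μ hs h hQ
    exact (h1.mul h4).add (h2.mul h3)
  have hcont : ∀ ξ, ContinuousOn (G ξ) (Icc (ν - 1) (ν + 1)) := by
    intro ξ
    rw [continuousOn_iff_continuous_domRestrict]
    apply SeqContinuous.continuous
    intro xs x hx
    have hmem : ∀ y : Icc (ν - 1) (ν + 1), |(y : ℝ) - ν| ≤ 1 := fun y => by
      rw [abs_le]; constructor <;> linarith [y.2.1, y.2.2]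
    exact hGt (fun _ => ξ) (fun j => xs j) ξ x (fun j => hmem _) (hmem _)
      (qconv_const (V ξ) ((continuous_subtype_val.tendsto x).comp hx))
  -- the base point
  have hc0 := hc ξ0 ν hνν
  have hu := (hp ξ0 ν hνν).unit
  have hu' := (hm ξ0 ν hνν).unit
  have hG0 : up ξ0 ν 0 * wm ξ0 ν 0 + wp ξ0 ν 0 * um ξ0 ν 0 = 0 := by
    obtain ⟨u, w, hs, hi, hne⟩ := hE
    obtain ⟨s, _, h⟩ := exists_EF (hV.contq _ _) hc0 hs hi hne
    have e1 := RT.unique (hV.contq _ _) hc0.right (hp ξ0 ν hνν) h.rt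
    obtain ⟨τ, _, h2⟩ := sign_RT ((hV.contq ξ0 ν).comp continuous_neg) hc0.neg.right h.rt.sol.neg
      (by simpa using h.rt.unit) h.left
    have e2 := RT.unique ((hV.contq ξ0 ν).comp continuous_neg) hc0.neg.right (hm ξ0 ν hνν) h2
    rw [e1.1, e1.2, e2.1, e2.2]
    simp only [neg_zero]; ring
  set t := up ξ0 ν 0 * um ξ0 ν 0 - wp ξ0 ν 0 * wm ξ0 ν 0 with ht
  have hsign : ∀ δs : ℕ → ℝ, Tendsto δs atTop (𝓝 0) → (∀ j, |δs j| ≤ 1) →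
      ∀ᶠ j in atTop, ∃ P > 0, t * G ξ0 (ν + δs j) = δs j * P := by
    intro δs hδ hδ1
    have hb : ∀ j, |ν + δs j - ν| ≤ 1 := fun j => by simpa using hδ1 j
    have hμ : Tendsto (fun j => ν + δs j) atTop (𝓝 ν) := by simpa using hδ.const_add ν
    obtain ⟨Is, I, hI, tI, eI⟩ := RT.seq hR (hV.cont ξ0) hc0.right (fun j => (hc ξ0 _ (hb j)).right) hμ
      (fun j => hp _ _ (hb j)) (hp ξ0 ν hνν)
    obtain ⟨Is', I', hI', tI', eI'⟩ := RT.seq (v := fun x => V ξ0 (-x)) hR ((hV.cont ξ0).comp continuous_neg)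
      hc0.neg.right
      (fun j => (hc ξ0 _ (hb j)).neg.right) hμ (fun j => hm _ _ (hb j)) (hm ξ0 ν hνν)
    obtain ⟨h1, h2, h3, h4⟩ := hGc (fun _ => ξ0) (fun j => ν + δs j) ξ0 ν hb hνν (qconv_const (V ξ0) hμ)
    have hP := ((((h1.mul_const (up ξ0 ν 0)).add (h2.mul_const (wp ξ0 ν 0))).mul tI').add
      (((h3.mul_const (um ξ0 ν 0)).add (h4.mul_const (wm ξ0 ν 0))).mul tI))
    have hpos : 0 < (up ξ0 ν 0 * up ξ0 ν 0 + wp ξ0 ν 0 * wp ξ0 ν 0) * I' +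
        (um ξ0 ν 0 * um ξ0 ν 0 + wm ξ0 ν 0 * wm ξ0 ν 0) * I := by
      rw [← sq, ← sq, ← sq, ← sq, hu, hu']; linarith
    filter_upwards [eI, eI', hP.eventually (lt_mem_nhds hpos)] with j e e' hj
    refine ⟨_, hj, ?_⟩
    rw [add_sub_cancel_left] at e e'
    exact alg_G hu hu' hG0 e e'
  obtain ⟨η, hη0, hη1, hηε, ⟨P, hP, eP⟩, ⟨P', hP', eP'⟩⟩ : ∃ η : ℝ, 0 < η ∧ η ≤ 1 ∧ η < ε ∧
      (∃ P > 0, t * G ξ0 (ν + η) = η * P) ∧ (∃ P > 0, t * G ξ0 (ν + -η) = -η * P) := by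
    have hz : Tendsto (fun j : ℕ => 1 / ((j : ℝ) + 1)) atTop (𝓝 0) := tendsto_one_div_add_atTop_nhds_zero_nat
    have hz1 : ∀ j : ℕ, 1 / ((j : ℝ) + 1) ≤ 1 := fun j => by
      rw [div_le_one (by positivity)]; have : (0:ℝ) ≤ j := j.cast_nonneg; linarith
    have hz0 : ∀ j : ℕ, 0 < 1 / ((j : ℝ) + 1) := fun j => by positivity
    have e1 := hsign _ hz (fun j => by rw [abs_of_pos (hz0 j)]; exact hz1 j)
    have e2 := hsign (fun j : ℕ => -(1 / ((j : ℝ) + 1))) (by simpa using hz.neg)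
      (fun j => by rw [abs_neg, abs_of_pos (hz0 j)]; exact hz1 j)
    obtain ⟨j, h1, h2, h3⟩ := (e1.and (e2.and (hz.eventually (gt_mem_nhds hε)))).exists
    exact ⟨_, hz0 j, hz1 j, h3, h1, h2⟩
  by_contra hcon
  push Not at hcon
  choose ξs hξs hξn using fun j : ℕ => hcon (1 / ((j : ℝ) + 1)) (by positivity)
  have hξ : Tendsto ξs atTop (𝓝 ξ0) := by
    rw [tendsto_iff_norm_sub_tendsto_zero]
    exact squeeze_zero (fun _ => norm_nonneg _) (fun j => (hξs j).le) tendsto_one_div_add_atTop_nhds_zero_nat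
  have hb1 : |ν + η - ν| ≤ 1 := by rw [add_sub_cancel_left, abs_of_pos hη0]; exact hη1
  have hb2 : |ν + -η - ν| ≤ 1 := by rw [add_sub_cancel_left, abs_neg, abs_of_pos hη0]; exact hη1
  have t1 := (hGt ξs (fun _ => ν + η) ξ0 (ν + η) (fun _ => hb1) hb1 (hV.qconv hξ tendsto_const_nhds)).const_mul t
  have t2 := (hGt ξs (fun _ => ν + -η) ξ0 (ν + -η) (fun _ => hb2) hb2 (hV.qconv hξ tendsto_const_nhds)).const_mul t
  have p1 : 0 < t * G ξ0 (ν + η) := by rw [eP]; positivity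
  have p2 : t * G ξ0 (ν + -η) < 0 := by rw [eP']; nlinarith
  obtain ⟨j, j1, j2⟩ := ((t1.eventually (lt_mem_nhds p1)).and (t2.eventually (gt_mem_nhds p2))).exists
  have hsub : Icc (ν + -η) (ν + η) ⊆ Icc (ν - 1) (ν + 1) := Icc_subset_Icc (by linarith) (by linarith)
  have := intermediate_value_Icc (by linarith) (((hcont (ξs j)).mono hsub).const_smul t)
  obtain ⟨μ, hμ, hμ0⟩ := this (show (0:ℝ) ∈ Icc _ _ from ⟨j2.le, j1.le⟩)
  have hμν : |μ - ν| ≤ η := by rw [abs_le]; constructor <;> linarith [hμ.1, hμ.2]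
  have ht0 : t ≠ 0 := by
    intro h; rw [h] at p1; simp at p1
  have hz : G (ξs j) μ = 0 := by
    have : t * G (ξs j) μ = 0 := hμ0
    exact (mul_eq_zero.1 this).resolve_left ht0
  exact hξn j μ (by linarith) (hGE _ _ (hμν.trans hη1) hz)
end
end FH


namespace FH
open Set Topology

section
variable {V : ℝ → ℝ → ℝ} {ξ0 L : ℝ}

lemma Fam.tendsto_ev (hV : Fam V ξ0 L) {ν : ℝ → ℕ → ℝ} (hmono : ∀ ξ, StrictMono (ν ξ))
    (heig : ∀ ξ n, Eig (fun x => V ξ x - ν ξ n)) (hall : ∀ ξ μ, Eig (fun x => V ξ x - μ) → ∃ n, μ = ν ξ n)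
    (n : ℕ) : ∀ ξs : ℕ → ℝ, Tendsto ξs atTop (𝓝 ξ0) → Tendsto (fun j => ν (ξs j) n) atTop (𝓝 (ν ξ0 n)) := by
  induction n using Nat.strong_induction_on with
  | _ n ih =>
  intro ξs hξ
  have upper : ∀ ε > 0, ∀ᶠ j in atTop, ν (ξs j) n < ν ξ0 n + ε := by
    intro ε hε
    obtain ⟨g, hg, hlow⟩ : ∃ g > 0, ∀ᶠ j in atTop, ∀ i < n, ν (ξs j) i < ν ξ0 n - g := by
      rcases n with _ | k
      · exact ⟨1, one_pos, Eventually.of_forall fun j i hi => absurd hi (Nat.not_lt_zero i)⟩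
      · have h1 := hmono ξ0 (Nat.lt_succ_self k)
        refine ⟨(ν ξ0 (k+1) - ν ξ0 k) / 2, by linarith [h1], ?_⟩
        have h2 := (ih k (Nat.lt_succ_self k) ξs hξ).eventually
          (gt_mem_nhds (show ν ξ0 k < ν ξ0 (k+1) - (ν ξ0 (k+1) - ν ξ0 k) / 2 by linarith [h1]))
        filter_upwards [h2] with j hj i hi
        exact ((hmono (ξs j)).monotone (Nat.lt_succ_iff.1 hi)).trans_lt hj
    obtain ⟨δ, hδ, hex⟩ := hV.exists_eig (heig ξ0 n) (ε := min ε g) (lt_min hε hg)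
    have hnear : ∀ᶠ j in atTop, |ξs j - ξ0| < δ := (Metric.tendsto_nhds.1 hξ δ hδ)
    filter_upwards [hlow, hnear] with j h1 h2
    obtain ⟨μ, hμ, hE⟩ := hex (ξs j) h2
    obtain ⟨m, rfl⟩ := hall _ _ hE
    rw [abs_lt] at hμ
    have hmn : n ≤ m := by
      by_contra hlt
      push Not at hlt
      have := h1 m hlt
      linarith [min_le_right ε g, hμ.1]
    have := (hmono (ξs j)).monotone hmn
    linarith [min_le_left ε g, hμ.2]
  have lower : ∀ ε > 0, ∀ᶠ j in atTop, ν ξ0 n - ε < ν (ξs j) n := by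
    intro ε hε
    by_contra hcon
    rw [not_eventually] at hcon
    obtain ⟨φ, hφ, hφ2⟩ := extraction_of_frequently_atTop hcon
    have hmem : ∀ j, ν (ξs (φ j)) n ∈ Icc (-1) (ν ξ0 n - ε) := fun j =>
      ⟨(hV.lower (heig _ _)).le, not_lt.1 (hφ2 j)⟩
    obtain ⟨μ, hμ, ψ, hψ, hψt⟩ := isCompact_Icc.tendsto_subseq hmem
    have hξ' : Tendsto (fun j => ξs (φ (ψ j))) atTop (𝓝 ξ0) :=
      hξ.comp (hφ.tendsto_atTop.comp hψ.tendsto_atTop)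
    have hn1 : ∀ᶠ j in atTop, |ν (ξs (φ (ψ j))) n - μ| < 1 := Metric.tendsto_nhds.1 hψt 1 one_pos
    obtain ⟨N, hN⟩ := eventually_atTop.1 hn1
    have hsh := tendsto_add_atTop_nat N
    have hE := hV.closed (hξ'.comp hsh) (hψt.comp hsh) (fun j => (hN (j + N) (Nat.le_add_left _ _)).le)
      (fun j => heig _ _)
    obtain ⟨m, hm⟩ := hall _ _ hE
    have hmn : m < n := by
      rw [← (hmono ξ0).lt_iff_lt, ← hm]; linarith [hμ.2]
    have hmt := ih m hmn _ hξ'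
    rw [← hm] at hmt
    have hn2 : ∀ᶠ j in atTop, |ν (ξs (φ (ψ j))) m - μ| < 1 := Metric.tendsto_nhds.1 hmt 1 one_pos
    obtain ⟨N', hN'⟩ := eventually_atTop.1 (hn1.and hn2)
    have hsh' := tendsto_add_atTop_nat N'
    exact hV.single (hξ'.comp hsh') (hψt.comp hsh') (hmt.comp hsh')
      (fun j => (hN' (j + N') (Nat.le_add_left _ _)).1.le)
      (fun j => (hN' (j + N') (Nat.le_add_left _ _)).2.le) (fun j => heig _ _) (fun j => heig _ _)
      (fun j => ((hmono _) hmn).ne')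
  rw [Metric.tendsto_nhds]
  intro ε hε
  filter_upwards [upper ε hε, lower ε hε] with j h1 h2
  rw [Real.dist_eq, abs_lt]
  constructor <;> linarith

theorem Fam.main (hV : Fam V ξ0 L) {ν : ℝ → ℕ → ℝ} (hmono : ∀ ξ, StrictMono (ν ξ))
    (heig : ∀ ξ n, Eig (fun x => V ξ x - ν ξ n)) (hall : ∀ ξ μ, Eig (fun x => V ξ x - μ) → ∃ n, μ = ν ξ n)
    (n : ℕ) {H0 W0 D : ℝ → ℝ} (hS : Sol (fun x => V ξ0 x - ν ξ0 n) H0 W0) (hi : Integrable (fun x => H0 x ^ 2))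
    (hn : ∫ x, H0 x ^ 2 = 1) (hD : ∀ x, HasDerivAt (fun ξ => V ξ x) (D x) ξ0) :
    HasDerivAt (fun ξ => ν ξ n) (∫ x, D x * H0 x ^ 2) ξ0 := by
  rw [hasDerivAt_iff_tendsto_slope]
  apply tendsto_of_seq_tendsto
  intro ξs hξs
  obtain ⟨hξ, hne⟩ := tendsto_nhdsWithin_iff.1 hξs
  have ht := hV.tendsto_ev hmono heig hall n ξs hξ
  have h1 : ∀ᶠ j in atTop, |ν (ξs j) n - ν ξ0 n| < 1 := Metric.tendsto_nhds.1 ht 1 one_pos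
  obtain ⟨N, hN⟩ := eventually_atTop.1 (h1.and hne)
  have hsh := tendsto_add_atTop_nat N
  rw [← tendsto_add_atTop_iff_nat N]
  have := hV.slope (hξ.comp hsh) (fun j => (hN (j + N) (Nat.le_add_left _ _)).2) (ht.comp hsh)
    (fun j => (hN (j + N) (Nat.le_add_left _ _)).1.le) (fun j => heig _ _) hS hi hn hD
  refine this.congr fun j => ?_
  simp [slope_def_field]
end
end FH


namespace FH
open Set Topology

lemma sol_of_eigenpair {b : ℝ → ℝ} {k μ : ℝ} {H : ℝ → ℝ} (h : IsEigenpair b k μ H) :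
    Sol (fun x => pot b k x - μ) H (deriv H) := by
  obtain ⟨h1, h2, _, _, h5⟩ := h
  refine ⟨fun x => ((h1.differentiable one_ne_zero) x).hasDerivAt, fun x => ?_⟩
  have := (h2 x).hasDerivAt
  rwa [show deriv (deriv H) x = (pot b k x - μ) * H x by linarith [h5 x]] at this

lemma eig_of_eigenpair {b : ℝ → ℝ} {k μ : ℝ} {H : ℝ → ℝ} (h : IsEigenpair b k μ H) :
    Eig (fun x => pot b k x - μ) := ⟨H, deriv H, sol_of_eigenpair h, h.2.2.1, h.2.2.2.1⟩

lemma eigenpair_of_eig {b : ℝ → ℝ} {k μ : ℝ} (h : Eig (fun x => pot b k x - μ)) :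
    ∃ H, IsEigenpair b k μ H := by
  obtain ⟨u, w, hs, hi, hne⟩ := h
  have hd : deriv u = w := funext fun x => (hs.hu x).deriv
  refine ⟨u, contDiff_one_iff_deriv.2 ⟨fun x => (hs.hu x).differentiableAt, by rw [hd]; exact hs.contw⟩,
    ?_, hi, hne, fun x => ?_⟩
  · rw [hd]; exact fun x => (hs.hw x).differentiableAt
  · rw [hd, (hs.hw x).deriv]; ring

lemma ii_of_bdd {f : ℝ → ℝ} {C : ℝ} (hf : AEStronglyMeasurable f volume) (hC : ∀ᵐ s, |f s| ≤ C) (x y : ℝ) :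
    IntervalIntegrable f volume x y :=
  IntervalIntegrable.mono_fun' (intervalIntegrable_const (c := C)) hf.restrict (ae_restrict_of_ae hC)

lemma prim_lower {f : ℝ → ℝ} {m : ℝ} (hi : ∀ x y, IntervalIntegrable f volume x y) (hm : ∀ᵐ s, m ≤ f s) (x : ℝ) :
    m * |x| ≤ |prim f x| := by
  rcases le_total 0 x with hx | hx
  · have := intervalIntegral.integral_mono_ae hx (intervalIntegrable_const (c := m)) (hi 0 x) hm
    rw [intervalIntegral.integral_const, smul_eq_mul, sub_zero] at this
    rw [abs_of_nonneg hx]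
    exact le_trans (b := prim f x) (by unfold prim; linarith) (le_abs_self _)
  · have := intervalIntegral.integral_mono_ae hx (intervalIntegrable_const (c := m)) (hi x 0) hm
    rw [intervalIntegral.integral_const, smul_eq_mul, intervalIntegral.integral_symm] at this
    rw [abs_of_nonpos hx]
    exact le_trans (b := -prim f x) (by unfold prim; linarith) (neg_le_abs _)

lemma fam_of_field {b : ℝ → ℝ → ℝ} {m C : ℝ} (hmeas : ∀ ξ, Measurable (b ξ)) (hm : 0 < m)
    (hbm : ∀ ξ, ∀ᵐ s : ℝ, m ≤ b ξ s)
    (hreg : ∀ᵐ s : ℝ, ∀ ξ : ℝ, DifferentiableAt ℝ (fun u => b u s) ξ)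
    (hbd : ∀ᵐ s : ℝ, ∀ ξ : ℝ, |b ξ s| ≤ C ∧ |deriv (fun u => b u s) ξ| ≤ C) (hC : 0 ≤ C) (ξ0 k : ℝ) :
    Fam (fun ξ => pot (b ξ) k) ξ0 (C * (2 * C + 2 * |k|)) := by
  have hi : ∀ ξ x y, IntervalIntegrable (b ξ) volume x y := fun ξ x y =>
    ii_of_bdd (hmeas ξ).aestronglyMeasurable (hbd.mono fun s hs => (hs ξ).1) x y
  have hpb : ∀ ξ x, |prim (b ξ) x| ≤ C * |x| := by
    intro ξ x
    have := intervalIntegral.norm_integral_le_of_norm_le_const_ae (a := 0) (b := x) (f := b ξ) (C := C)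
      (hbd.mono fun s hs _ => (hs ξ).1)
    simpa [prim] using this
  have hpd : ∀ ξ x, |prim (b ξ) x - prim (b ξ0) x| ≤ C * |ξ - ξ0| * |x| := by
    intro ξ x
    have := intervalIntegral.norm_integral_le_of_norm_le_const_ae (a := 0) (b := x)
      (f := fun s => b ξ s - b ξ0 s) (C := C * |ξ - ξ0|) (by
        filter_upwards [hreg, hbd] with s h1 h2 _
        exact Convex.norm_image_sub_le_of_norm_deriv_le (f := fun u => b u s) (fun u _ => h1 u)
          (fun u _ => (h2 u).2) convex_univ (mem_univ ξ0) (mem_univ ξ))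
    rw [intervalIntegral.integral_sub (hi _ _ _) (hi _ _ _), sub_zero] at this
    exact this
  refine ⟨fun ξ => ?_, fun ξ x => sq_nonneg _, fun ξ x => ?_, fun Λ => ?_⟩
  · have := intervalIntegral.continuous_primitive (hi ξ) 0
    exact (this.sub continuous_const).pow 2
  · have e : pot (b ξ) k x - pot (b ξ0) k x =
        (prim (b ξ) x - prim (b ξ0) x) * (prim (b ξ) x + prim (b ξ0) x - 2 * k) := by
      unfold pot; ring
    have h1 : |prim (b ξ) x + prim (b ξ0) x - 2 * k| ≤ 2 * C * |x| + 2 * |k| := by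
      have h2 := hpb ξ x
      have h3 := hpb ξ0 x
      rw [abs_le] at *
      constructor <;> nlinarith [le_abs_self k, neg_abs_le k]
    have hx : |x| * (2 * C * |x| + 2 * |k|) ≤ (2 * C + 2 * |k|) * (1 + x ^ 2) := by
      rw [← sq_abs x]
      have : |x| ≤ 1 + |x| ^ 2 := by nlinarith [sq_nonneg (|x| - 1), abs_nonneg x]
      nlinarith [mul_le_mul_of_nonneg_left this (abs_nonneg k), abs_nonneg k, sq_nonneg |x|]
    rw [e, abs_mul]
    calc _ ≤ (C * |ξ - ξ0| * |x|) * (2 * C * |x| + 2 * |k|) := by gcongr; exact hpd ξ x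
      _ = (C * |ξ - ξ0|) * (|x| * (2 * C * |x| + 2 * |k|)) := by ring
      _ ≤ (C * |ξ - ξ0|) * ((2 * C + 2 * |k|) * (1 + x ^ 2)) := by gcongr
      _ = _ := by ring
  · refine ⟨(|Λ| + 1 + |k|) / m, by positivity, fun ξ x hx => ?_⟩
    rw [div_le_iff₀ hm] at hx
    have h1 := prim_lower (hi ξ) (hbm ξ) x
    have h2 : |prim (b ξ) x| ≤ |prim (b ξ) x - k| + |k| := by
      simpa using abs_add_le (prim (b ξ) x - k) k
    have h3 : |Λ| + 1 ≤ |prim (b ξ) x - k| := by linarith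
    unfold pot
    rw [← sq_abs]
    nlinarith [le_abs_self Λ, abs_nonneg Λ]

lemma deriv_pot {b : ℝ → ℝ → ℝ} {C : ℝ} (hmeas : ∀ ξ, Measurable (b ξ))
    (hreg : ∀ᵐ s : ℝ, ∀ ξ : ℝ, DifferentiableAt ℝ (fun u => b u s) ξ)
    (hbd : ∀ᵐ s : ℝ, ∀ ξ : ℝ, |b ξ s| ≤ C ∧ |deriv (fun u => b u s) ξ| ≤ C) (ξ0 k x : ℝ) :
    HasDerivAt (fun ξ => pot (b ξ) k x)
      (2 * ((∫ t in (0:ℝ)..x, deriv (fun u => b u t) ξ0) * (prim (b ξ0) x - k))) ξ0 := by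
  have hm' : AEStronglyMeasurable (fun t => deriv (fun u => b u t) ξ0) volume := by
    refine aestronglyMeasurable_of_tendsto_ae (𝓝[≠] ξ0) (f := fun ξ t => slope (fun u => b u t) ξ0 ξ) ?_ ?_
    · intro ξ
      simp only [slope_def_field]
      exact (((hmeas ξ).sub (hmeas ξ0)).div_const _).aestronglyMeasurable
    · filter_upwards [hreg] with t ht
      exact hasDerivAt_iff_tendsto_slope.1 (ht ξ0).hasDerivAt
  have hp := (intervalIntegral.hasDerivAt_integral_of_dominated_loc_of_deriv_le (𝕜 := ℝ) (μ := volume) (a := 0) (b := x)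
    (bound := fun _ => C)
    (F := b) (F' := fun ξ t => deriv (fun u => b u t) ξ) (x₀ := ξ0) (s := univ) univ_mem
    (Eventually.of_forall fun ξ => (hmeas ξ).aestronglyMeasurable)
    (ii_of_bdd (hmeas ξ0).aestronglyMeasurable (hbd.mono fun s hs => (hs ξ0).1) 0 x)
    hm'.restrict (hbd.mono fun s hs _ ξ _ => (hs ξ).2) intervalIntegrable_const
    (hreg.mono fun s hs _ ξ _ => (hs ξ).hasDerivAt)).2
  have := (hp.sub_const k).pow 2
  convert! this using 1
  simp only [prim]; push_cast; ring
end FH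

/-- Feynman–Hellmann in `ξ`: for a magnetic intensity `b(ξ,s)` that is
twice differentiable in the (periodic) variable `ξ` with bounded derivatives, the band
function `ξ ↦ ν_n(ξ,k)` is differentiable with
`∂_ξ ν_n(ξ,k) = 2 ∫ (∫₀ˣ ∂_ξ b)(∫₀ˣ b - k) |H_n(ξ,k,x)|² dx`. -/
theorem feynman_hellmann_xi
    (b : ℝ → ℝ → ℝ) (m bp bm M : ℝ)
    (hb : ∀ ξ, Bfield (b ξ) m bp bm M)
    (hper : ∀ ξ s, b (ξ + 1) s = b ξ s)
    (hreg : ∀ᵐ s : ℝ, ∀ ξ : ℝ,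
      DifferentiableAt ℝ (fun u => b u s) ξ ∧
      DifferentiableAt ℝ (deriv fun u => b u s) ξ)
    (hbd : ∃ C : ℝ, ∀ᵐ s : ℝ, ∀ ξ : ℝ,
      |b ξ s| ≤ C ∧ |deriv (fun u => b u s) ξ| ≤ C ∧
      |deriv (deriv fun u => b u s) ξ| ≤ C)
    (n : ℕ)
    (ν : ℝ → ℝ → ℕ → ℝ) (hν : ∀ ξ k, IsEigList (b ξ) k (ν ξ k))
    (H : ℝ → ℝ → ℝ → ℝ)
    (hH : ∀ ξ k, IsEigenpair (b ξ) k (ν ξ k n) (H ξ k))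
    (hnorm : ∀ ξ k, ∫ x : ℝ, (H ξ k x) ^ 2 = 1) :
    ∀ ξ k : ℝ,
      HasDerivAt (fun u => ν u k n)
        (2 * ∫ x : ℝ,
          (∫ t in (0:ℝ)..x, deriv (fun u => b u t) ξ) *
            (prim (b ξ) x - k) * (H ξ k x) ^ 2) ξ := by
  intro ξ k
  obtain ⟨C, hC⟩ := hbd
  have hmeas : ∀ ξ, Measurable (b ξ) := fun ξ => (hb ξ).1
  have hm : 0 < m := (hb 0).2.2.1
  have hreg' : ∀ᵐ s : ℝ, ∀ ξ : ℝ, DifferentiableAt ℝ (fun u => b u s) ξ := hreg.mono fun s h ξ => (h ξ).1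
  have hbd' : ∀ᵐ s : ℝ, ∀ ξ : ℝ, |b ξ s| ≤ C ∧ |deriv (fun u => b u s) ξ| ≤ C :=
    hC.mono fun s h ξ => ⟨(h ξ).1, (h ξ).2.1⟩
  have hC0 : 0 ≤ C := by
    obtain ⟨s, hs⟩ := hC.exists
    exact (abs_nonneg _).trans (hs 0).1
  have hV := FH.fam_of_field hmeas hm (fun ξ => (hb ξ).2.2.2.1) hreg' hbd' hC0 ξ k
  have hmain := hV.main (ν := fun ξ => ν ξ k) (fun ξ => (hν ξ k).1)
    (fun ξ n => by
      obtain ⟨H, hH⟩ := (hν ξ k).2.1 n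
      exact FH.eig_of_eigenpair hH)
    (fun ξ μ hE => by
      obtain ⟨H, hH⟩ := FH.eigenpair_of_eig hE
      exact (hν ξ k).2.2 μ H hH)
    n (FH.sol_of_eigenpair (hH ξ k)) (hH ξ k).2.2.1 (hnorm ξ k)
    (FH.deriv_pot hmeas hreg' hbd' ξ k)
  convert! hmain using 1
  rw [← integral_const_mul]
  refine integral_congr_ae (Eventually.of_forall fun x => ?_)
  simp only; ring
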